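/- arXiv:2512.02001 — 2 statements merged into one kernel-verified Lean document; each statement's English description precedes it below -/
import Mathlib

section
/- Let p be an odd prime. For every integer k ≥ 1 there exists a constant K > 0 (depending on k and p) such that the following holds. Suppose 0 < ε < 1/11, ℓ,q ≥ 0 are integers, and 𝓑 = (L,Q) is a quadratic factor on 𝔽_p^n of complexity (ℓ,q) and rank at least K(ℓ+q+log_p(ε^(−1))). Suppose A ⊆ 𝔽_p^n satisfies VC₂(A) ≤ k, b ∈ 𝔽_p^ℓ × 𝔽_p^q, and ‖1_A − α_{B(b)}‖_{U³(b)}^P < (ε/4)^{k²·2^{k²}}·2^(−1), where α_{B(b)} = |A∩B(b)|/|B(b)| is the density of A on the atom B(b). Then α_{B(b)} ∈ [0,ε) ∪ (1−ε,1]. -/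
open scoped BigOperators symmDiff
open Finset

attribute [local instance] Classical.propDecidable

namespace PaperTS

noncomputable section

/-- The group `𝔽_p^n`, written additively. -/
abbrev Vec (p n : ℕ) := Fin n → ZMod p

/-- Dot product on `𝔽_p^n`. -/
def dot {p n : ℕ} (x y : Vec p n) : ZMod p := ∑ i, x i * y i

/-- A quadratic factor of complexity `(ℓ, q)` on `𝔽_p^n`: a set of `ℓ` linearly independent
vectors together with a set of `q` pairwise distinct symmetric matrices. -/
structure QuadFactor (p n ℓ q : ℕ) where
  L : Fin ℓ → Vec p n
  Q : Fin q → Matrix (Fin n) (Fin n) (ZMod p)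
  linIndep : LinearIndependent (ZMod p) L
  symm : ∀ j, (Q j).IsSymm
  inj : Function.Injective Q

/-- Labels of atoms of a quadratic factor of complexity `(ℓ, q)`. -/
abbrev Label (p ℓ q : ℕ) := (Fin ℓ → ZMod p) × (Fin q → ZMod p)

namespace QuadFactor

variable {p n ℓ q : ℕ}

/-- The linear form `β_L`. -/
def betaL (B : QuadFactor p n ℓ q) (x : Vec p n) : Fin ℓ → ZMod p :=
  fun i => dot x (B.L i)

/-- The bilinear form `β_Q`. -/
def betaQ (B : QuadFactor p n ℓ q) (x y : Vec p n) : Fin q → ZMod p :=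
  fun j => dot x ((B.Q j).mulVec y)

/-- The labelling map `β_𝓑`. -/
def betaB (B : QuadFactor p n ℓ q) (x : Vec p n) : Label p ℓ q :=
  (B.betaL x, B.betaQ x x)

/-- The atom of `B` with label `ab`. -/
def atom (B : QuadFactor p n ℓ q) (ab : Label p ℓ q) : Set (Vec p n) :=
  {x | B.betaB x = ab}

/-- The fibre `β_Q^{-1}(d) ⊆ G × G`. -/
def fibQ (B : QuadFactor p n ℓ q) (d : Fin q → ZMod p) : Set (Vec p n × Vec p n) :=
  {xy | B.betaQ xy.1 xy.2 = d}

/-- The rank of a quadratic factor: `n` if `q = 0`, and otherwise the minimal rank of a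
nontrivial linear combination of the matrices. -/
def rank (B : QuadFactor p n ℓ q) : ℕ :=
  if q = 0 then n
  else sInf ((fun c : Fin q → ZMod p => (∑ j, c j • B.Q j).rank) '' {c | c ≠ 0})

end QuadFactor

/-- Refinement of quadratic factors: every atom of `B'` is contained in an atom of `B`. -/
def Refines {p n ℓ' q' ℓ q : ℕ} (B' : QuadFactor p n ℓ' q') (B : QuadFactor p n ℓ q) : Prop :=
  ∀ ab' : Label p ℓ' q', ∃ ab : Label p ℓ q, B'.atom ab' ⊆ B.atom ab

/-- `Σ(d)` for a tuple of labels `d = (d_a, d_b, d_c, d_ab, d_ac, d_bc)`. -/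
def SigmaD {p ℓ q : ℕ} (da db dc : Label p ℓ q) (dab dac dbc : Fin q → ZMod p) :
    Label p ℓ q :=
  (da.1 + db.1 + dc.1, da.2 + db.2 + dc.2 + 2 • dab + 2 • dac + 2 • dbc)

/-- Real-valued indicator function of a set. -/
def ind1 {G : Type*} (S : Set G) : G → ℝ := S.indicator 1

/-- Density of `A` on `P`. -/
def density {G : Type*} (A P : Set G) : ℝ := ((A ∩ P).ncard : ℝ) / (P.ncard : ℝ)

/-- Sum of `g` over a set in a fintype. -/
def setSum {α : Type*} [Fintype α] (s : Set α) (g : α → ℝ) : ℝ :=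
  ∑ x ∈ Finset.univ.filter (fun x => x ∈ s), g x

/-- Average of `g` over a set in a fintype. -/
def expOver {α : Type*} [Fintype α] (s : Set α) (g : α → ℝ) : ℝ :=
  setSum s g / (s.ncard : ℝ)

/-- The normalized indicator `μ_Γ` of `Γ ⊆ G × G`. -/
def mu {G : Type*} [Fintype G] (Γ : Set (G × G)) (xy : G × G) : ℝ :=
  ((Fintype.card G : ℝ) ^ 2 / (Γ.ncard : ℝ)) * ind1 Γ xy

/-- The product of the 8 values of `f` on the cube generated by `x, h₁, h₂, h₃`. -/
def cubeProd {G : Type*} [AddCommGroup G] (f : G → ℝ) (x h₁ h₂ h₃ : G) : ℝ :=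
  f x * f (x + h₁) * f (x + h₂) * f (x + h₃) * f (x + h₁ + h₂) * f (x + h₁ + h₃) *
    f (x + h₂ + h₃) * f (x + h₁ + h₂ + h₃)

/-- The eighth power of the (unnormalized) `U³` norm. -/
def U3pow8 {G : Type*} [AddCommGroup G] [Fintype G] (f : G → ℝ) : ℝ :=
  ∑ x : G, ∑ h₁ : G, ∑ h₂ : G, ∑ h₃ : G, cubeProd f x h₁ h₂ h₃

/-- The (unnormalized) `U³` norm. -/
def U3norm {G : Type*} [AddCommGroup G] [Fintype G] (f : G → ℝ) : ℝ :=
  U3pow8 f ^ ((1 : ℝ) / 8)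

/-- The Prendiville local `U³` norm of `f` relative to the set `B`
(equal to `0` when `‖1_B‖_{U³} = 0`, by the division-by-zero convention). -/
def U3localP {G : Type*} [AddCommGroup G] [Fintype G] (f : G → ℝ) (B : Set G) : ℝ :=
  U3norm (fun x => f x * ind1 B x) / U3norm (ind1 B)

/-- `Ω_B`: the 4-tuples all of whose associated cube points lie in `B`. -/
def Omega {G : Type*} [AddCommGroup G] (B : Set G) : Set (G × G × G × G) :=
  fun t =>
    match t with
    | (x, h₁, h₂, h₃) =>
        x ∈ B ∧ x + h₁ ∈ B ∧ x + h₂ ∈ B ∧ x + h₃ ∈ B ∧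
        x + h₁ + h₂ ∈ B ∧ x + h₁ + h₃ ∈ B ∧ x + h₂ + h₃ ∈ B ∧ x + h₁ + h₂ + h₃ ∈ B

/-- The change of variables `Ψ : G⁶ → G⁴`. -/
def Psi {G : Type*} [AddCommGroup G] : G × G × G × G × G × G → G × G × G × G :=
  fun t =>
    match t with
    | (x₁, x₂, y₁, y₂, z₁, z₂) => (x₁ + y₁ + z₁, x₂ - x₁, y₂ - y₁, z₂ - z₁)

/-- `K_{2,2,2}(d)`. -/
def K222 {p n ℓ q : ℕ} (B : QuadFactor p n ℓ q) (da db dc : Label p ℓ q)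
    (dab dac dbc : Fin q → ZMod p) :
    Set (Vec p n × Vec p n × Vec p n × Vec p n × Vec p n × Vec p n) :=
  fun t =>
    match t with
    | (x₁, x₂, y₁, y₂, z₁, z₂) =>
        B.betaB x₁ = da ∧ B.betaB x₂ = da ∧ B.betaB y₁ = db ∧ B.betaB y₂ = db ∧
        B.betaB z₁ = dc ∧ B.betaB z₂ = dc ∧
        B.betaQ x₁ y₁ = dab ∧ B.betaQ x₁ y₂ = dab ∧ B.betaQ x₂ y₁ = dab ∧ B.betaQ x₂ y₂ = dab ∧
        B.betaQ x₁ z₁ = dac ∧ B.betaQ x₁ z₂ = dac ∧ B.betaQ x₂ z₁ = dac ∧ B.betaQ x₂ z₂ = dac ∧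
        B.betaQ y₁ z₁ = dbc ∧ B.betaQ y₁ z₂ = dbc ∧ B.betaQ y₂ z₁ = dbc ∧ B.betaQ y₂ z₂ = dbc

/-- The product `∏_{i,j,k ∈ {1,2}} f (x_i + y_j + z_k)` for a 6-tuple. -/
def prod8 {G : Type*} [AddCommGroup G] (f : G → ℝ) :
    G × G × G × G × G × G → ℝ :=
  fun t =>
    match t with
    | (x₁, x₂, y₁, y₂, z₁, z₂) =>
        f (x₁ + y₁ + z₁) * f (x₁ + y₁ + z₂) * f (x₁ + y₂ + z₁) * f (x₁ + y₂ + z₂) *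
        f (x₂ + y₁ + z₁) * f (x₂ + y₁ + z₂) * f (x₂ + y₂ + z₁) * f (x₂ + y₂ + z₂)

/-- The eighth power of the Terry–Wolf local `U³` norm. -/
def TW8 {p n ℓ q : ℕ} [NeZero p] (B : QuadFactor p n ℓ q) (f : Vec p n → ℝ)
    (da db dc : Label p ℓ q) (dab dac dbc : Fin q → ZMod p) : ℝ :=
  expOver (B.atom da) fun x₀ => expOver (B.atom da) fun x₁ =>
  expOver (B.atom db) fun y₀ => expOver (B.atom db) fun y₁ =>
  expOver (B.atom dc) fun z₀ => expOver (B.atom dc) fun z₁ =>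
    (mu (B.fibQ dab) (x₀, y₀) * mu (B.fibQ dab) (x₀, y₁) *
     mu (B.fibQ dab) (x₁, y₀) * mu (B.fibQ dab) (x₁, y₁) *
     mu (B.fibQ dac) (x₀, z₀) * mu (B.fibQ dac) (x₀, z₁) *
     mu (B.fibQ dac) (x₁, z₀) * mu (B.fibQ dac) (x₁, z₁) *
     mu (B.fibQ dbc) (y₀, z₀) * mu (B.fibQ dbc) (y₀, z₁) *
     mu (B.fibQ dbc) (y₁, z₀) * mu (B.fibQ dbc) (y₁, z₁)) *
    prod8 f (x₀, x₁, y₀, y₁, z₀, z₁)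

/-- `A` has VC₂-dimension at least `k`. -/
def HasVC2Dim {G : Type*} [AddCommGroup G] (A : Set G) (k : ℕ) : Prop :=
  ∃ (a b : Fin k → G) (c : Set (Fin k × Fin k) → G),
    ∀ (i j : Fin k) (S : Set (Fin k × Fin k)), (a i + b j + c S ∈ A ↔ (i, j) ∈ S)

/-- `A` has VC₂-dimension at most `k`. -/
def VC2dimLE {G : Type*} [AddCommGroup G] (A : Set G) (k : ℕ) : Prop :=
  ∀ m : ℕ, HasVC2Dim A m → m ≤ k

/-- A growth function: an increasing function `ℝ → ℝ≥0`. -/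
def GrowthFunction (ρ : ℝ → ℝ) : Prop :=
  Monotone ρ ∧ ∀ x, 0 ≤ ρ x

/-- `ρ` is bounded by a polynomial of degree `d` on `[1, ∞)`. -/
def PolyBound (ρ : ℝ → ℝ) (d : ℕ) : Prop :=
  ∃ C > (0 : ℝ), ∀ x : ℝ, 1 ≤ x → ρ x ≤ C * x ^ d

/-- `ρ` is a polynomial growth function of degree (exactly) `d`, i.e. `d ≥ 1` is minimal
with `ρ(x) ≤ C x^d` for `x ≥ 1`. -/
def PolyGrowthDegree (ρ : ℝ → ℝ) (d : ℕ) : Prop :=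
  1 ≤ d ∧ PolyBound ρ d ∧ ∀ d' : ℕ, 1 ≤ d' → PolyBound ρ d' → d ≤ d'

/-- The index `ind(A, 𝒫)` of a partition. -/
def indx {p n : ℕ} (A : Set (Vec p n)) (Ps : Finset (Set (Vec p n))) : ℝ :=
  (∑ P ∈ Ps, density A P ^ 2 * (P.ncard : ℝ)) / (p : ℝ) ^ n

/-- `P` fails to be `δ`-uniform for `A` with respect to the localized `U³` norm. -/
def BadPart {G : Type*} [AddCommGroup G] [Fintype G] (δ : ℝ) (A P : Set G) : Prop :=
  δ * U3norm (ind1 P) < U3norm (fun x => (ind1 A x - density A P) * ind1 P x)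

/-- `ker(U)^⊥`, the orthogonal complement of the kernel of `U`. -/
def kerPerp {p n : ℕ} (U : Matrix (Fin n) (Fin n) (ZMod p)) : Set (Vec p n) :=
  {v | ∀ w : Vec p n, U.mulVec w = 0 → dot v w = 0}

/-- `B'` is a `ρ`-matrix deletion of `B`. -/
def IsMatrixDeletion {p n ℓ' q' ℓ q : ℕ} (ρ : ℝ → ℝ)
    (B' : QuadFactor p n ℓ' q') (B : QuadFactor p n ℓ q) : Prop :=
  q' + 1 = q ∧
  ∃ c : Fin q → ZMod p, c ≠ 0 ∧
    (((∑ j, c j • B.Q j).rank : ℝ) < ρ ((ℓ : ℝ) + (q : ℝ))) ∧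
    (∃ i : Fin q, c i ≠ 0 ∧ Set.range B'.Q = Set.range B.Q \ {B.Q i}) ∧
    Set.range B.L ⊆ Set.range B'.L ∧
    Submodule.span (ZMod p) (Set.range B'.L) =
      Submodule.span (ZMod p) (Set.range B.L ∪ kerPerp (∑ j, c j • B.Q j))

/-- The functions `τ_i^ρ : ℤ × ℤ → ℝ`. -/
def tau (ρ : ℝ → ℝ) : ℕ → ℤ × ℤ → ℝ
  | 0, xy => (xy.1 : ℝ)
  | i + 1, xy => tau ρ i xy + ρ (tau ρ i xy + (xy.2 : ℝ) - (i : ℝ))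

/-- `f_σ^ρ` for binary strings `σ : Fin m → ℤ` (with values in `{-1, 1}`). -/
def fseq (ρ : ℝ → ℝ) : (m : ℕ) → (Fin m → ℤ) → ℝ × ℝ
  | 0, _ => (0, 0)
  | m + 1, σ =>
      let ab := fseq ρ m (fun j => σ j.castSucc)
      if σ (Fin.last m) = 1 then (ab.1 + 1, ab.2 + 1)
      else (ab.1 + ρ (ab.1 + ab.2), ab.2 - 1)

end

open scoped Matrix in
/-- Orthogonality of the additive characters of `𝔽_p^ι`. -/
lemma sum_stdAddChar_dotProduct {p : ℕ} [Fact p.Prime] {ι : Type*} [Fintype ι] [DecidableEq ι]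
    (w : ι → ZMod p) :
    ∑ x : ι → ZMod p, ZMod.stdAddChar (x ⬝ᵥ w) =
      if w = 0 then (p : ℂ) ^ Fintype.card ι else 0 := by
  let φ : (ι → ZMod p) →+ ZMod p :=
    { toFun := fun x => x ⬝ᵥ w
      map_zero' := zero_dotProduct w
      map_add' := fun x y => add_dotProduct x y w }
  have h := AddChar.sum_eq_ite ((ZMod.stdAddChar (N := p)).compAddMonoidHom φ)
  have h2 : ((ZMod.stdAddChar (N := p)).compAddMonoidHom φ = 0) ↔ w = 0 := by
    constructor
    · intro h0
      ext i
      have h3 := DFunLike.congr_fun h0 (Pi.single i 1)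
      have h4 : ZMod.stdAddChar (w i) = 1 := by
        simpa [φ, single_dotProduct] using h3
      rw [← AddChar.map_zero_eq_one (ZMod.stdAddChar (N := p))] at h4
      exact ZMod.injective_stdAddChar h4
    · rintro rfl
      ext x
      simp [φ]
  have h5 : ∑ x : ι → ZMod p, ZMod.stdAddChar (x ⬝ᵥ w) =
      ∑ x, ((ZMod.stdAddChar (N := p)).compAddMonoidHom φ) x := rfl
  rw [h5, h]
  by_cases hw : w = 0
  · rw [if_pos (h2.2 hw), if_pos hw]
    simp [ZMod.card]
  · rw [if_neg (fun h => hw (h2.1 h)), if_neg hw]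

open scoped Matrix in
/-- A fibre of a map into `𝔽_p^ι` has close to the expected size if all nontrivial character
sums are small. -/
lemma card_fibre_sub_le {p : ℕ} [Fact p.Prime] {ι Z : Type*} [Fintype ι] [Fintype Z]
       (Ψ : Z → ι → ZMod p) (d : ι → ZMod p) (M : ℝ) (hMn : 0 ≤ M)
    (hM : ∀ c : ι → ZMod p, c ≠ 0 → ‖∑ z, ZMod.stdAddChar (c ⬝ᵥ Ψ z)‖ ≤ M) :
    |((univ.filter fun z => Ψ z = d).card : ℝ) -
      Fintype.card Z / (p : ℝ) ^ Fintype.card ι| ≤ M := by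
  have hp : (0 : ℝ) < (p : ℝ) ^ Fintype.card ι := by
    have := (Fact.out : p.Prime).pos
    positivity
  have key : ((p : ℂ) ^ Fintype.card ι) * ((univ.filter fun z => Ψ z = d).card : ℂ) =
      ∑ c : ι → ZMod p, ZMod.stdAddChar (-(c ⬝ᵥ d)) * ∑ z, ZMod.stdAddChar (c ⬝ᵥ Ψ z) := by
    simp_rw [Finset.mul_sum]
    rw [Finset.sum_comm]
    simp_rw [← AddChar.map_add_eq_mul]
    have : ∀ z, ∑ c : ι → ZMod p, ZMod.stdAddChar (-(c ⬝ᵥ d) + c ⬝ᵥ Ψ z) =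
        if Ψ z = d then (p : ℂ) ^ Fintype.card ι else 0 := by
      intro z
      have h := sum_stdAddChar_dotProduct (Ψ z - d)
      simp only [sub_eq_zero] at h
      rw [← h]
      refine Finset.sum_congr rfl fun c _ => ?_
      rw [dotProduct_sub]
      congr 1
      ring
    rw [Finset.sum_congr rfl fun z _ => this z, ← Finset.sum_filter, Finset.sum_const,
      nsmul_eq_mul, mul_comm]
  rw [← Finset.add_sum_erase _ _ (Finset.mem_univ (0 : ι → ZMod p))] at key
  simp only [zero_dotProduct, neg_zero, AddChar.map_zero_eq_one, one_mul, Finset.sum_const,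
    Finset.card_univ, nsmul_eq_mul, mul_one] at key
  have hb : ‖∑ c ∈ univ.erase (0 : ι → ZMod p),
      ZMod.stdAddChar (-(c ⬝ᵥ d)) * ∑ z, ZMod.stdAddChar (c ⬝ᵥ Ψ z)‖ ≤
      (p : ℝ) ^ Fintype.card ι * M := by
    have hM0 : ∀ c ∈ univ.erase (0 : ι → ZMod p),
        ‖ZMod.stdAddChar (-(c ⬝ᵥ d)) * ∑ z, ZMod.stdAddChar (c ⬝ᵥ Ψ z)‖ ≤ M := by
      intro c hc
      rw [norm_mul, AddChar.norm_apply, one_mul]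
      exact hM c (Finset.ne_of_mem_erase hc)
    refine (norm_sum_le_of_le _ hM0).trans ?_
    rw [Finset.sum_const, nsmul_eq_mul]
    refine mul_le_mul_of_nonneg_right ?_ hMn
    have : ((univ.erase (0 : ι → ZMod p)).card : ℝ) ≤ (Fintype.card (ι → ZMod p) : ℝ) := by
      exact_mod_cast (Finset.card_le_card (Finset.erase_subset _ _))
    simpa [ZMod.card] using this
  have hk : (p : ℂ) ^ Fintype.card ι *
      ((((univ.filter fun z => Ψ z = d).card : ℝ) -
        Fintype.card Z / (p : ℝ) ^ Fintype.card ι : ℝ) : ℂ) =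
      ∑ c ∈ univ.erase (0 : ι → ZMod p),
      ZMod.stdAddChar (-(c ⬝ᵥ d)) * ∑ z, ZMod.stdAddChar (c ⬝ᵥ Ψ z) := by
    have hp' : (p : ℂ) ^ Fintype.card ι ≠ 0 := by exact_mod_cast hp.ne'
    push_cast
    rw [mul_sub, key, mul_div_cancel₀ _ hp']
    ring
  rw [← hk, norm_mul, Complex.norm_real, Real.norm_eq_abs, norm_pow, Complex.norm_natCast] at hb
  exact le_of_mul_le_mul_left hb hp

open scoped Matrix in
lemma card_ker_mul_pow_rank {p n : ℕ} [Fact p.Prime] (M : Matrix (Fin n) (Fin n) (ZMod p)) :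
    (univ.filter fun y : Vec p n => M *ᵥ y = 0).card * p ^ M.rank = p ^ n := by
  have h1 := LinearMap.finrank_range_add_finrank_ker M.mulVecLin
  have h2 : Fintype.card (LinearMap.ker M.mulVecLin) =
      (univ.filter fun y : Vec p n => M *ᵥ y = 0).card := by
    rw [Fintype.card_subtype]
    congr 1
    ext y
    simp
  rw [← h2, Module.card_eq_pow_finrank (K := ZMod p), ZMod.card, ← pow_add, Matrix.rank, add_comm,
    h1]
  simp

open scoped Matrix in
/-- A bilinear exponential sum twisted by arbitrary bounded functions of each variable is
controlled by the rank of the bilinear form. -/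
lemma norm_bilinear_sum_le {p n : ℕ} [Fact p.Prime] (M : Matrix (Fin n) (Fin n) (ZMod p))
    (a b : Vec p n → ℂ) (ha : ∀ x, ‖a x‖ ≤ 1) (hb : ∀ x, ‖b x‖ ≤ 1) :
    ‖∑ x, ∑ y, a x * b y * ZMod.stdAddChar (x ⬝ᵥ M *ᵥ y)‖ ^ 2 * (p : ℝ) ^ M.rank ≤
      ((p : ℝ) ^ n) ^ 4 := by
  have hcard : (Fintype.card (Vec p n) : ℝ) = (p : ℝ) ^ n := by simp [ZMod.card]
  set S : Vec p n → ℂ := fun x => ∑ y, b y * ZMod.stdAddChar (x ⬝ᵥ M *ᵥ y) with hS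
  have h1 : ‖∑ x, ∑ y, a x * b y * ZMod.stdAddChar (x ⬝ᵥ M *ᵥ y)‖ ≤ ∑ x, ‖S x‖ := by
    refine norm_sum_le_of_le _ fun x _ => ?_
    have : ∑ y, a x * b y * ZMod.stdAddChar (x ⬝ᵥ M *ᵥ y) = a x * S x := by
      rw [hS, Finset.mul_sum]
      exact Finset.sum_congr rfl fun y _ => by ring
    rw [this, norm_mul]
    exact mul_le_of_le_one_left (norm_nonneg _) (ha x)
  have h2 : (∑ x, ‖S x‖) ^ 2 ≤ (p : ℝ) ^ n * ∑ x, ‖S x‖ ^ 2 := by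
    have := sq_sum_le_card_mul_sum_sq (s := (univ : Finset (Vec p n))) (f := fun x => ‖S x‖)
    rwa [Finset.card_univ, hcard] at this
  have h3 : ((∑ x, ‖S x‖ ^ 2 : ℝ) : ℂ) = ∑ y, ∑ y', b y * (starRingEnd ℂ) (b y') *
      if M *ᵥ (y - y') = 0 then (p : ℂ) ^ n else 0 := by
    push_cast
    have e1 : ∀ x, ((‖S x‖ : ℂ)) ^ 2 = ∑ y, ∑ y', b y * (starRingEnd ℂ) (b y') *
        ZMod.stdAddChar (x ⬝ᵥ (M *ᵥ (y - y'))) := by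
      intro x
      rw [← Complex.mul_conj', hS]
      simp only [map_sum, Finset.sum_mul_sum, map_mul]
      refine Finset.sum_congr rfl fun y _ => Finset.sum_congr rfl fun y' _ => ?_
      rw [← AddChar.map_neg_eq_conj, Matrix.mulVec_sub, dotProduct_sub, sub_eq_add_neg,
        AddChar.map_add_eq_mul]
      ring
    simp_rw [e1]
    rw [Finset.sum_comm]
    refine Finset.sum_congr rfl fun y _ => ?_
    rw [Finset.sum_comm]
    refine Finset.sum_congr rfl fun y' _ => ?_
    rw [← Finset.mul_sum, sum_stdAddChar_dotProduct, Fintype.card_fin]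
  have h4 : ∑ x, ‖S x‖ ^ 2 ≤
      (p : ℝ) ^ n * ((p : ℝ) ^ n * (univ.filter fun y : Vec p n => M *ᵥ y = 0).card) := by
    have h5 : ∑ x, ‖S x‖ ^ 2 = ‖((∑ x, ‖S x‖ ^ 2 : ℝ) : ℂ)‖ := by
      rw [Complex.norm_real, Real.norm_of_nonneg (by positivity)]
    rw [h5, h3]
    have h6 : ∀ y ∈ (univ : Finset (Vec p n)), ‖∑ y', b y * (starRingEnd ℂ) (b y') *
        if M *ᵥ (y - y') = 0 then (p : ℂ) ^ n else 0‖ ≤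
        (p : ℝ) ^ n * (univ.filter fun y : Vec p n => M *ᵥ y = 0).card := by
      intro y _
      have h7 : ∀ y' ∈ (univ : Finset (Vec p n)), ‖b y * (starRingEnd ℂ) (b y') *
          if M *ᵥ (y - y') = 0 then (p : ℂ) ^ n else 0‖ ≤
          if M *ᵥ (y - y') = 0 then (p : ℝ) ^ n else 0 := by
        intro y' _
        have h8 : ‖b y‖ * ‖b y'‖ ≤ 1 := mul_le_one₀ (hb y) (norm_nonneg _) (hb y')
        split_ifs
        · rw [norm_mul, norm_mul, RCLike.norm_conj, norm_pow, Complex.norm_natCast]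
          exact mul_le_of_le_one_left (by positivity) h8
        · simp
      refine (norm_sum_le_of_le _ h7).trans (le_of_eq ?_)
      rw [← Fintype.sum_equiv (Equiv.subLeft y)
        (fun z => if M *ᵥ z = 0 then (p : ℝ) ^ n else 0) _
        (fun z => by simp), ← Finset.sum_filter, Finset.sum_const, nsmul_eq_mul, mul_comm]
    refine (norm_sum_le_of_le _ h6).trans (le_of_eq ?_)
    rw [Finset.sum_const, nsmul_eq_mul, Finset.card_univ, hcard]
  have h9 : ((univ.filter fun y : Vec p n => M *ᵥ y = 0).card : ℝ) * (p : ℝ) ^ M.rank =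
      (p : ℝ) ^ n := by exact_mod_cast card_ker_mul_pow_rank M
  calc ‖∑ x, ∑ y, a x * b y * ZMod.stdAddChar (x ⬝ᵥ M *ᵥ y)‖ ^ 2 * (p : ℝ) ^ M.rank
      ≤ ((p : ℝ) ^ n * ((p : ℝ) ^ n *
        ((p : ℝ) ^ n * (univ.filter fun y : Vec p n => M *ᵥ y = 0).card))) *
          (p : ℝ) ^ M.rank := by
        gcongr
        exact (pow_le_pow_left₀ (norm_nonneg _) h1 2).trans (h2.trans (by gcongr))
    _ = ((p : ℝ) ^ n) ^ 3 * (((univ.filter fun y : Vec p n => M *ᵥ y = 0).card : ℝ) *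
          (p : ℝ) ^ M.rank) := by ring
    _ = ((p : ℝ) ^ n) ^ 4 := by rw [h9]; ring

open scoped Matrix in
lemma norm_bilinear_sum_le_mul {p n : ℕ} [Fact p.Prime] (M : Matrix (Fin n) (Fin n) (ZMod p))
    (a b : Vec p n → ℂ) (ha : ∀ x, ‖a x‖ ≤ 1) (hb : ∀ x, ‖b x‖ ≤ 1)
    (s : ℝ) (hs : 0 ≤ s) (hsM : 1 ≤ s ^ 2 * (p : ℝ) ^ M.rank) :
    ‖∑ x, ∑ y, a x * b y * ZMod.stdAddChar (x ⬝ᵥ M *ᵥ y)‖ ≤ ((p : ℝ) ^ n) ^ 2 * s := by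
  have hp : (0 : ℝ) < p := by exact_mod_cast (Fact.out : p.Prime).pos
  have h := norm_bilinear_sum_le M a b ha hb
  refine le_of_sq_le_sq ?_ (by positivity)
  refine le_of_mul_le_mul_right (h.trans ?_) (pow_pos hp M.rank)
  calc ((p : ℝ) ^ n) ^ 4 = ((p : ℝ) ^ n) ^ 4 * 1 := by ring
    _ ≤ ((p : ℝ) ^ n) ^ 4 * (s ^ 2 * (p : ℝ) ^ M.rank) := by gcongr
    _ = _ := by ring

lemma norm_sum_le_of_translates {p n : ℕ} [Fact p.Prime] {Z : Type*} [AddCommGroup Z] [Fintype Z]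
    (F : Z → ℂ) (σ : Vec p n → Z) (M : ℝ)
    (h : ∀ z, ‖∑ x, F (z + σ x)‖ ≤ (p : ℝ) ^ n * M) :
    ‖∑ z, F z‖ ≤ Fintype.card Z * M := by
  have hp : (0 : ℝ) < (p : ℝ) ^ n := by
    have := (Fact.out : p.Prime).pos
    positivity
  have h1 : ((p : ℂ) ^ n) * ∑ z, F z = ∑ z, ∑ x, F (z + σ x) := by
    rw [Finset.sum_comm]
    have : ∀ x, ∑ z, F (z + σ x) = ∑ z, F z := fun x =>
      Fintype.sum_equiv (Equiv.addRight (σ x)) _ _ (fun z => rfl)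
    simp [this, ZMod.card]
  have h2 : ‖∑ z, ∑ x, F (z + σ x)‖ ≤ Fintype.card Z * ((p : ℝ) ^ n * M) := by
    refine (norm_sum_le_of_le _ fun z _ => h z).trans (le_of_eq ?_)
    simp
  rw [← h1, norm_mul, norm_pow, Complex.norm_natCast] at h2
  refine le_of_mul_le_mul_left (h2.trans (le_of_eq ?_)) hp
  ring

open scoped Matrix in
/-- An exponential sum whose phase has mixed second difference a bilinear form of large rank
is small. -/
lemma norm_sum_le_of_mixed_difference {p n : ℕ} [Fact p.Prime] {Z : Type*} [AddCommGroup Z]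
    [Fintype Z] (φ : Z → ZMod p) (σ τ : Vec p n → Z) (M : Matrix (Fin n) (Fin n) (ZMod p))
    (hφ : ∀ z x y, φ (z + σ x + τ y) = φ (z + σ x) + φ (z + τ y) - φ z + x ⬝ᵥ M *ᵥ y)
    (s : ℝ) (hs : 0 ≤ s) (hsM : 1 ≤ s ^ 2 * (p : ℝ) ^ M.rank) :
    ‖∑ z, ZMod.stdAddChar (φ z)‖ ≤ Fintype.card Z * s := by
  have hp : (0 : ℝ) < (p : ℝ) ^ n := by
    have := (Fact.out : p.Prime).pos
    positivity
  have h0 : ∀ z, ‖∑ x, ∑ y, ZMod.stdAddChar (φ (z + σ x + τ y))‖ ≤ ((p : ℝ) ^ n) ^ 2 * s := by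
    intro z
    have h1 := norm_bilinear_sum_le_mul M
      (fun x => ZMod.stdAddChar (φ (z + σ x) - φ z)) (fun y => ZMod.stdAddChar (φ (z + τ y)))
      (fun x => (AddChar.norm_apply _ _).le) (fun x => (AddChar.norm_apply _ _).le) s hs hsM
    refine le_trans (le_of_eq ?_) h1
    congr 1
    refine Finset.sum_congr rfl fun x _ => Finset.sum_congr rfl fun y _ => ?_
    rw [hφ, ← AddChar.map_add_eq_mul, ← AddChar.map_add_eq_mul]
    congr 1
    ring
  have h1 : ((p : ℂ) ^ n) * ∑ z, (ZMod.stdAddChar (φ z) : ℂ) =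
      ∑ z, ∑ y, ZMod.stdAddChar (φ (z + τ y)) := by
    rw [Finset.sum_comm]
    have : ∀ x, ∑ z, (ZMod.stdAddChar (φ (z + τ x)) : ℂ) = ∑ z, ZMod.stdAddChar (φ z) := fun x =>
      Fintype.sum_equiv (Equiv.addRight (τ x)) _ _ (fun z => rfl)
    simp [this, ZMod.card]
  have h2 := norm_sum_le_of_translates
    (fun z => ∑ y, (ZMod.stdAddChar (φ (z + τ y)) : ℂ)) σ ((p : ℝ) ^ n * s)
    (fun z => (h0 z).trans (le_of_eq (by ring)))
  rw [← h1, norm_mul, norm_pow, Complex.norm_natCast] at h2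
  refine le_of_mul_le_mul_left (h2.trans (le_of_eq ?_)) hp
  ring

open scoped Matrix in
/-- An exponential sum with a quadratic phase of large rank is small. -/
lemma norm_sum_le_of_second_difference {p n : ℕ} [Fact p.Prime] {Z : Type*} [AddCommGroup Z]
    [Fintype Z] (φ : Z → ZMod p) (σ : Vec p n →+ Z) (M : Matrix (Fin n) (Fin n) (ZMod p))
    (hφ : ∀ z x y, φ (z + σ x + σ y) = φ (z + σ x) + φ (z + σ y) - φ z + x ⬝ᵥ M *ᵥ y)
    (e : ℝ) (he : 0 ≤ e) (heM : 1 ≤ e ^ 4 * (p : ℝ) ^ M.rank) :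
    ‖∑ z, ZMod.stdAddChar (φ z)‖ ≤ Fintype.card Z * e := by
  refine norm_sum_le_of_translates _ σ e fun z => ?_
  have hp : (0 : ℝ) < (p : ℝ) ^ n := by
    have := (Fact.out : p.Prime).pos
    positivity
  refine le_of_sq_le_sq ?_ (by positivity)
  have h1 := norm_bilinear_sum_le_mul M
    (fun _ => 1) (fun y => ZMod.stdAddChar (φ (z + σ y) - φ z))
    (fun x => by simp) (fun x => (AddChar.norm_apply _ _).le) (e ^ 2) (by positivity)
    (by rw [← pow_mul]; exact heM)
  refine le_trans (le_of_eq ?_) (h1.trans (le_of_eq (by ring)))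
  have h2 : ((‖∑ x, (ZMod.stdAddChar (φ (z + σ x)) : ℂ)‖ ^ 2 : ℝ) : ℂ) =
      ∑ x, ∑ y, 1 * ZMod.stdAddChar (φ (z + σ y) - φ z) * ZMod.stdAddChar (x ⬝ᵥ M *ᵥ y) := by
    push_cast
    rw [← Complex.conj_mul', map_sum, Finset.sum_mul_sum]
    refine Finset.sum_congr rfl fun x _ => ?_
    rw [← Fintype.sum_equiv (Equiv.addLeft x) (fun y => (starRingEnd ℂ)
      (ZMod.stdAddChar (φ (z + σ x))) * (ZMod.stdAddChar (φ (z + σ (x + y))) : ℂ)) _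
      (fun y => rfl)]
    refine Finset.sum_congr rfl fun y _ => ?_
    rw [← AddChar.map_neg_eq_conj, map_add, ← add_assoc, hφ, one_mul, ← AddChar.map_add_eq_mul,
      ← AddChar.map_add_eq_mul]
    congr 1
    ring
  rw [← h2, Complex.norm_real, Real.norm_of_nonneg (by positivity)]

namespace QuadFactor

variable {p n ℓ q : ℕ}

lemma rank_le_rank_sum (B : QuadFactor p n ℓ q) (c : Fin q → ZMod p) (hc : c ≠ 0) :
    B.rank ≤ (∑ j, c j • B.Q j).rank := by
  have hq : q ≠ 0 := by
    rintro rfl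
    exact hc (Subsingleton.elim _ _)
  rw [QuadFactor.rank, if_neg hq]
  exact Nat.sInf_le ⟨c, hc, rfl⟩

end QuadFactor

open scoped Matrix in
/-- The phases occurring in the Fourier expansion of a system of quadratic constraints. -/
def systemPhase {p n : ℕ} {V E : Type*} [Fintype V] [Fintype E] (o : V) (s t : E → V)
    (w : V → Vec p n) (N : V → Matrix (Fin n) (Fin n) (ZMod p))
    (K : E → Matrix (Fin n) (Fin n) (ZMod p)) (z : V → Vec p n) : ZMod p :=
  ∑ v, z v ⬝ᵥ w v + ∑ v, z v ⬝ᵥ N v *ᵥ z v +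
    ∑ e, (z (s e) - z o) ⬝ᵥ K e *ᵥ (z (t e) - z o)

open scoped Matrix in
lemma bilin_mixed_difference {p n : ℕ} (M : Matrix (Fin n) (Fin n) (ZMod p))
    (u w x₁ x₂ y₁ y₂ : Vec p n) :
    (u + x₁ + y₁) ⬝ᵥ M *ᵥ (w + x₂ + y₂) = (u + x₁) ⬝ᵥ M *ᵥ (w + x₂) +
      (u + y₁) ⬝ᵥ M *ᵥ (w + y₂) - u ⬝ᵥ M *ᵥ w + (x₁ ⬝ᵥ M *ᵥ y₂ + y₁ ⬝ᵥ M *ᵥ x₂) := by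
  simp only [Matrix.mulVec_add, dotProduct_add, add_dotProduct]
  ring

open scoped Matrix in
lemma systemPhase_edge {p n : ℕ} {V E : Type*} [Fintype V] [DecidableEq V] [Fintype E] (o : V)
    (s t : E → V)
    (hs : ∀ e, s e ≠ o) (ht : ∀ e, t e ≠ o) (hst : ∀ e, s e ≠ t e)
    (hinj : ∀ e e', s e = s e' → t e = t e' → e = e')
    (hsw : ∀ e e', s e = t e' → t e ≠ s e')
    (w : V → Vec p n) (N : V → Matrix (Fin n) (Fin n) (ZMod p))
    (K : E → Matrix (Fin n) (Fin n) (ZMod p)) (e₀ : E) (z : V → Vec p n) (x y : Vec p n) :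
    systemPhase o s t w N K (z + (Pi.single (s e₀) x : V → Vec p n) +
        (Pi.single (t e₀) y : V → Vec p n)) =
      systemPhase o s t w N K (z + (Pi.single (s e₀) x : V → Vec p n)) +
      systemPhase o s t w N K (z + (Pi.single (t e₀) y : V → Vec p n)) - systemPhase o s t w N K z +
      x ⬝ᵥ K e₀ *ᵥ y := by
  have h1 : ∀ v,
      (z + (Pi.single (s e₀) x : V → Vec p n) + (Pi.single (t e₀) y : V → Vec p n)) v ⬝ᵥ w v =
      (z + (Pi.single (s e₀) x : V → Vec p n)) v ⬝ᵥ w v +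
          (z + (Pi.single (t e₀) y : V → Vec p n)) v ⬝ᵥ w v - z v ⬝ᵥ w v := by
    intro v
    simp only [Pi.add_apply, add_dotProduct]
    ring
  have h2 : ∀ v, (z + (Pi.single (s e₀) x : V → Vec p n) + (Pi.single (t e₀) y : V → Vec p n)) v ⬝ᵥ
        N v *ᵥ (z + (Pi.single (s e₀) x : V → Vec p n) + (Pi.single (t e₀) y : V → Vec p n)) v =
      (z + (Pi.single (s e₀) x : V → Vec p n)) v ⬝ᵥ N v *ᵥ (z +
          (Pi.single (s e₀) x : V → Vec p n)) v +
      (z + (Pi.single (t e₀) y : V → Vec p n)) v ⬝ᵥ N v *ᵥ (z +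
          (Pi.single (t e₀) y : V → Vec p n)) v - z v ⬝ᵥ N v *ᵥ z v := by
    intro v
    simp only [Pi.add_apply]
    rw [bilin_mixed_difference]
    have : v ≠ s e₀ ∨ v ≠ t e₀ := by
      by_contra! h
      exact hst e₀ (h.1.symm.trans h.2)
    rcases this with h | h
    · simp [Pi.single_eq_of_ne h]
    · simp [Pi.single_eq_of_ne h]
  have h3 : ∀ e,
      ((z + (Pi.single (s e₀) x : V → Vec p n) + (Pi.single (t e₀) y : V → Vec p n)) (s e) -
          (z + (Pi.single (s e₀) x : V → Vec p n) + (Pi.single (t e₀) y : V → Vec p n)) o) ⬝ᵥ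
        K e *ᵥ ((z + (Pi.single (s e₀) x : V → Vec p n) +
            (Pi.single (t e₀) y : V → Vec p n)) (t e) -
          (z + (Pi.single (s e₀) x : V → Vec p n) + (Pi.single (t e₀) y : V → Vec p n)) o) =
      ((z + (Pi.single (s e₀) x : V → Vec p n)) (s e) -
          (z + (Pi.single (s e₀) x : V → Vec p n)) o) ⬝ᵥ
        K e *ᵥ ((z + (Pi.single (s e₀) x : V → Vec p n)) (t e) -
            (z + (Pi.single (s e₀) x : V → Vec p n)) o) +
      ((z + (Pi.single (t e₀) y : V → Vec p n)) (s e) -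
          (z + (Pi.single (t e₀) y : V → Vec p n)) o) ⬝ᵥ
        K e *ᵥ ((z + (Pi.single (t e₀) y : V → Vec p n)) (t e) -
            (z + (Pi.single (t e₀) y : V → Vec p n)) o) -
      (z (s e) - z o) ⬝ᵥ K e *ᵥ (z (t e) - z o) + if e = e₀ then x ⬝ᵥ K e₀ *ᵥ y else 0 := by
    intro e
    simp only [Pi.add_apply, Pi.single_eq_of_ne (hs e₀).symm, Pi.single_eq_of_ne (ht e₀).symm,
      add_zero]
    have r1 : ∀ (u : Vec p n) (a b c : Vec p n), a + b + c - u = (a - u) + b + c :=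
      fun u a b c => by abel
    have r2 : ∀ (u : Vec p n) (a b : Vec p n), a + b - u = (a - u) + b :=
      fun u a b => by abel
    rw [r1, r1, r2, r2, r2, r2, bilin_mixed_difference]
    congr 1
    by_cases he : e = e₀
    · subst he
      simp [Pi.single_eq_of_ne (hst e), Pi.single_eq_of_ne (hst e).symm]
    · rw [if_neg he]
      have a1 : (Pi.single (s e₀) x : V → Vec p n) (s e) ⬝ᵥ
          K e *ᵥ (Pi.single (t e₀) y : V → Vec p n) (t e) = 0 := by
        by_cases h : s e = s e₀
        · have h' : t e ≠ t e₀ := fun h' => he (hinj e e₀ h h')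
          rw [Pi.single_eq_of_ne h']
          simp
        · rw [Pi.single_eq_of_ne h]
          simp
      have a2 : (Pi.single (t e₀) y : V → Vec p n) (s e) ⬝ᵥ
          K e *ᵥ (Pi.single (s e₀) x : V → Vec p n) (t e) = 0 := by
        by_cases h : s e = t e₀
        · rw [Pi.single_eq_of_ne (hsw e e₀ h)]
          simp
        · rw [Pi.single_eq_of_ne h]
          simp
      rw [a1, a2, add_zero]
  rw [systemPhase, Finset.sum_congr rfl fun v _ => h1 v, Finset.sum_congr rfl fun v _ => h2 v,
    Finset.sum_congr rfl fun e _ => h3 e]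
  simp only [Finset.sum_add_distrib, Finset.sum_sub_distrib, Finset.sum_ite_eq', Finset.mem_univ,
    if_true, systemPhase]
  ring

open scoped Matrix in
lemma systemPhase_diag {p n : ℕ} {V E : Type*} [Fintype V] [DecidableEq V] [Fintype E] (o : V)
    (s t : E → V)
    (w : V → Vec p n) (N : V → Matrix (Fin n) (Fin n) (ZMod p)) (v₀ : V)
    (hN : (N v₀).IsSymm) (z : V → Vec p n) (x y : Vec p n) :
    systemPhase o s t w N 0 (z + (Pi.single v₀ x : V → Vec p n) + (Pi.single v₀ y : V → Vec p n)) =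
      systemPhase o s t w N 0 (z + (Pi.single v₀ x : V → Vec p n)) +
      systemPhase o s t w N 0 (z + (Pi.single v₀ y : V → Vec p n)) - systemPhase o s t w N 0 z +
      x ⬝ᵥ ((2 : ZMod p) • N v₀) *ᵥ y := by
  have h1 : ∀ v, (z + (Pi.single v₀ x : V → Vec p n) + (Pi.single v₀ y : V → Vec p n)) v ⬝ᵥ w v =
      (z + (Pi.single v₀ x : V → Vec p n)) v ⬝ᵥ w v +
          (z + (Pi.single v₀ y : V → Vec p n)) v ⬝ᵥ w v - z v ⬝ᵥ w v := by
    intro v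
    simp only [Pi.add_apply, add_dotProduct]
    ring
  have hsym : y ⬝ᵥ N v₀ *ᵥ x = x ⬝ᵥ N v₀ *ᵥ y := by
    rw [Matrix.dotProduct_mulVec, ← Matrix.mulVec_transpose, hN.eq, dotProduct_comm]
  have h2 : ∀ v, (z + (Pi.single v₀ x : V → Vec p n) + (Pi.single v₀ y : V → Vec p n)) v ⬝ᵥ
        N v *ᵥ (z + (Pi.single v₀ x : V → Vec p n) + (Pi.single v₀ y : V → Vec p n)) v =
      (z + (Pi.single v₀ x : V → Vec p n)) v ⬝ᵥ N v *ᵥ (z + (Pi.single v₀ x : V → Vec p n)) v +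
      (z + (Pi.single v₀ y : V → Vec p n)) v ⬝ᵥ N v *ᵥ (z + (Pi.single v₀ y : V → Vec p n)) v -
          z v ⬝ᵥ N v *ᵥ z v +
      if v = v₀ then x ⬝ᵥ ((2 : ZMod p) • N v₀) *ᵥ y else 0 := by
    intro v
    simp only [Pi.add_apply]
    rw [bilin_mixed_difference]
    congr 1
    by_cases h : v = v₀
    · subst h
      rw [Pi.single_eq_same, Pi.single_eq_same, hsym, if_pos rfl, Matrix.smul_mulVec,
        dotProduct_smul, smul_eq_mul]
      ring
    · simp [h]
  rw [systemPhase, Finset.sum_congr rfl fun v _ => h1 v, Finset.sum_congr rfl fun v _ => h2 v]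
  simp only [Finset.sum_add_distrib, Finset.sum_sub_distrib, Finset.sum_ite_eq', Finset.mem_univ,
    if_true, systemPhase, Pi.zero_apply, Matrix.zero_mulVec, dotProduct_zero,
    Finset.sum_const_zero]
  ring

open scoped Matrix in
lemma sum_systemPhase_linear_eq_zero {p n : ℕ} [Fact p.Prime] {V E : Type*} [Fintype V]
    [DecidableEq V] [Fintype E] (o : V) (s t : E → V) (w : V → Vec p n) (v₀ : V) (hw : w v₀ ≠ 0) :
    ∑ z, (ZMod.stdAddChar (systemPhase o s t w 0 (0 : E → Matrix (Fin n) (Fin n) (ZMod p)) z) : ℂ)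
        = 0 := by
  have h := norm_sum_le_of_translates (Z := V → Vec p n)
    (fun z => (ZMod.stdAddChar (systemPhase o s t w 0
        (0 : E → Matrix (Fin n) (Fin n) (ZMod p)) z) : ℂ))
    (fun x => (Pi.single v₀ x : V → Vec p n)) 0 (fun z => by
      have h1 : ∀ x : Vec p n, systemPhase o s t w 0
          (0 : E → Matrix (Fin n) (Fin n) (ZMod p)) (z + (Pi.single v₀ x : V → Vec p n)) =
          systemPhase o s t w 0 (0 : E → Matrix (Fin n) (Fin n) (ZMod p)) z + x ⬝ᵥ w v₀ := by
        intro x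
        have h2 : ∀ v, (z + (Pi.single v₀ x : V → Vec p n)) v ⬝ᵥ w v =
            z v ⬝ᵥ w v + if v = v₀ then x ⬝ᵥ w v₀ else 0 := by
          intro v
          rw [Pi.add_apply, add_dotProduct]
          congr 1
          by_cases h : v = v₀
          · subst h
            simp
          · simp [h]
        simp only [systemPhase, h2, Finset.sum_add_distrib, Finset.sum_ite_eq', Finset.mem_univ,
          if_true, Pi.zero_apply, Matrix.zero_mulVec, dotProduct_zero, Finset.sum_const_zero,
          add_zero]
      simp_rw [h1, AddChar.map_add_eq_mul, ← Finset.mul_sum]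
      rw [sum_stdAddChar_dotProduct, if_neg hw]
      simp)
  rw [mul_zero] at h
  exact norm_le_zero_iff.1 h

namespace QuadFactor

variable {p n ℓ q : ℕ}

open scoped Matrix in
lemma mem_atom_iff (B : QuadFactor p n ℓ q) (b : Label p ℓ q) (x : Vec p n) :
    x ∈ B.atom b ↔ (∀ i, x ⬝ᵥ B.L i = b.1 i) ∧ ∀ j, x ⬝ᵥ B.Q j *ᵥ x = b.2 j := by
  rw [atom, Set.mem_ofPred_eq, betaB, Prod.ext_iff, funext_iff, funext_iff]
  rfl

open scoped Matrix in
/-- The evaluation map of the linear and quadratic constraints attached to a system of vertices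
and edges. -/
def systemMap {V E : Type*} (B : QuadFactor p n ℓ q) (o : V) (s t : E → V) (z : V → Vec p n) :
    (V × Fin ℓ) ⊕ (V × Fin q) ⊕ (E × Fin q) → ZMod p :=
  Sum.elim (fun vi => z vi.1 ⬝ᵥ B.L vi.2)
    (Sum.elim (fun vj => z vj.1 ⬝ᵥ B.Q vj.2 *ᵥ z vj.1)
      (fun ej => (z (s ej.1) - z o) ⬝ᵥ B.Q ej.2 *ᵥ (z (t ej.1) - z o)))

open scoped Matrix in
lemma dotProduct_systemMap {V E : Type*} [Fintype V] [Fintype E] (B : QuadFactor p n ℓ q)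
    (o : V) (s t : E → V) (c : (V × Fin ℓ) ⊕ (V × Fin q) ⊕ (E × Fin q) → ZMod p)
    (z : V → Vec p n) :
    c ⬝ᵥ B.systemMap o s t z =
      systemPhase o s t (fun v => ∑ i, c (.inl (v, i)) • B.L i)
        (fun v => ∑ j, c (.inr (.inl (v, j))) • B.Q j)
        (fun e => ∑ j, c (.inr (.inr (e, j))) • B.Q j) z := by
  simp only [dotProduct, systemPhase, systemMap, Fintype.sum_sum_type, Sum.elim_inl, Sum.elim_inr,
    Fintype.sum_prod_type, ← add_assoc]
  congr 1
  · congr 1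
    · refine Finset.sum_congr rfl fun v _ => ?_
      change ∑ i, c (.inl (v, i)) * (z v ⬝ᵥ B.L i) = z v ⬝ᵥ ∑ i, c (.inl (v, i)) • B.L i
      rw [dotProduct_sum]
      simp
    · refine Finset.sum_congr rfl fun v _ => ?_
      change ∑ i, c (.inr (.inl (v, i))) * (z v ⬝ᵥ B.Q i *ᵥ z v) =
        z v ⬝ᵥ (∑ i, c (.inr (.inl (v, i))) • B.Q i) *ᵥ z v
      rw [Matrix.sum_mulVec, dotProduct_sum]
      simp [Matrix.smul_mulVec]
  · refine Finset.sum_congr rfl fun e _ => ?_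
    change ∑ i, c (.inr (.inr (e, i))) * ((z (s e) - z o) ⬝ᵥ B.Q i *ᵥ (z (t e) - z o)) =
        (z (s e) - z o) ⬝ᵥ (∑ i, c (.inr (.inr (e, i))) • B.Q i) *ᵥ (z (t e) - z o)
    rw [Matrix.sum_mulVec, dotProduct_sum]
    simp [Matrix.smul_mulVec]

lemma one_le_pow_mul_pow_rank [Fact p.Prime] (B : QuadFactor p n ℓ q) (e : ℝ)
    (he : 1 ≤ e ^ 4 * (p : ℝ) ^ B.rank) (c : Fin q → ZMod p) (hc : c ≠ 0) :
    1 ≤ e ^ 4 * (p : ℝ) ^ (∑ j, c j • B.Q j).rank := by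
  refine he.trans ?_
  have : (1 : ℝ) ≤ p := by exact_mod_cast (Fact.out : p.Prime).one_le
  gcongr
  exact B.rank_le_rank_sum c hc

open scoped Matrix in
/-- The number of solutions of a system of linear and quadratic constraints over a quadratic
factor of high rank. -/
lemma card_system [Fact p.Prime] (hodd : Odd p) {V E : Type*} [Fintype V] [DecidableEq V]
    [Fintype E]
    (B : QuadFactor p n ℓ q) (b : Label p ℓ q) (o : V) (s t : E → V)
    (hs : ∀ e, s e ≠ o) (ht : ∀ e, t e ≠ o) (hst : ∀ e, s e ≠ t e)
    (hinj : ∀ e e', s e = s e' → t e = t e' → e = e')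
    (hsw : ∀ e e', s e = t e' → t e ≠ s e')
    (e : ℝ) (he0 : 0 ≤ e) (he1 : e ≤ 1) (he : 1 ≤ e ^ 4 * (p : ℝ) ^ B.rank) :
    |((univ.filter fun z : V → Vec p n => (∀ v, z v ∈ B.atom b) ∧
        ∀ i, B.betaQ (z (s i) - z o) (z (t i) - z o) = 0).card : ℝ) -
      ((p : ℝ) ^ n) ^ Fintype.card V / (p : ℝ) ^
        (Fintype.card V * ℓ + (Fintype.card V * q + Fintype.card E * q))| ≤
      ((p : ℝ) ^ n) ^ Fintype.card V * e := by
  have hcard : (Fintype.card (V → Vec p n) : ℝ) = ((p : ℝ) ^ n) ^ Fintype.card V := by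
    simp [ZMod.card]
  have h := card_fibre_sub_le (B.systemMap o s t)
    (Sum.elim (fun vi => b.1 vi.2) (Sum.elim (fun vj => b.2 vj.2) 0))
    (((p : ℝ) ^ n) ^ Fintype.card V * e) (by positivity) ?_
  · have hS : (univ.filter fun z : V → Vec p n => (∀ v, z v ∈ B.atom b) ∧
        ∀ i, B.betaQ (z (s i) - z o) (z (t i) - z o) = 0) = univ.filter fun z =>
        B.systemMap o s t z =
          Sum.elim (fun vi => b.1 vi.2) (Sum.elim (fun vj => b.2 vj.2) 0) := by
      ext z
      simp only [mem_filter, mem_univ, true_and, mem_atom_iff, funext_iff, Sum.forall, systemMap,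
          Sum.elim_inl, Sum.elim_inr,
        Prod.forall, forall_and, Pi.zero_apply, and_assoc]
      rfl
    rw [hcard] at h
    rw [hS]
    convert h using 4
    simp
  intro c hc
  rw [← hcard]
  simp_rw [dotProduct_systemMap]
  by_cases hK : ∃ i, (fun j => c (.inr (.inr (i, j)))) ≠ 0
  · obtain ⟨i, hi⟩ := hK
    have h1 : e ^ 2 ≤ e := by nlinarith
    refine le_trans (norm_sum_le_of_mixed_difference _ (fun x => Pi.single (s i) x)
      (fun y => Pi.single (t i) y) _
      (fun z x y => systemPhase_edge o s t hs ht hst hinj hsw _ _ _ i z x y) (e ^ 2)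
      (by positivity) ?_) (by gcongr)
    rw [← pow_mul]
    exact B.one_le_pow_mul_pow_rank e he _ hi
  have hK' : (fun i => ∑ j, c (.inr (.inr (i, j))) • B.Q j) =
      (0 : E → Matrix (Fin n) (Fin n) (ZMod p)) := by
    push Not at hK
    funext i
    have := hK i
    rw [funext_iff] at this
    simp only [Pi.zero_apply] at this
    simp [this]
  rw [hK']
  by_cases hN : ∃ i, (fun j => c (.inr (.inl (i, j)))) ≠ 0
  · obtain ⟨i, hi⟩ := hN
    have hsymm : (∑ j, c (.inr (.inl (i, j))) • B.Q j).IsSymm := by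
      rw [Matrix.IsSymm, Matrix.transpose_sum]
      refine Finset.sum_congr rfl fun j _ => ?_
      rw [Matrix.transpose_smul, (B.symm j).eq]
    have h2 : (2 : ZMod p) ≠ 0 := by
      have : ((2 : ℕ) : ZMod p) ≠ 0 := by
        rw [Ne, ZMod.natCast_eq_zero_iff]
        intro h
        have := (Nat.prime_dvd_prime_iff_eq Fact.out Nat.prime_two).1 h
        subst this
        exact absurd hodd (by decide)
      exact_mod_cast this
    refine norm_sum_le_of_second_difference _
      (AddMonoidHom.single (fun _ : V => Vec p n) i) _
      (fun z x y => systemPhase_diag o s t _ _ i hsymm z x y) e he0 ?_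
    have := B.one_le_pow_mul_pow_rank e he ((2 : ZMod p) • fun j => c (.inr (.inl (i, j))))
      (smul_ne_zero h2 hi)
    simpa [Finset.smul_sum, smul_smul] using this
  have hN' : (fun i => ∑ j, c (.inr (.inl (i, j))) • B.Q j) =
      (0 : V → Matrix (Fin n) (Fin n) (ZMod p)) := by
    push Not at hN
    funext i
    have := hN i
    rw [funext_iff] at this
    simp only [Pi.zero_apply] at this
    simp [this]
  rw [hN']
  push Not at hN hK
  have hL : ∃ v, (fun j => c (.inl (v, j))) ≠ 0 := by
    by_contra! hL
    refine hc (funext fun x => ?_)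
    rcases x with ⟨v, i⟩ | ⟨v, j⟩ | ⟨v, j⟩
    · exact congrFun (hL v) i
    · exact congrFun (hN v) j
    · exact congrFun (hK v) j
  obtain ⟨v, hv⟩ := hL
  rw [sum_systemPhase_linear_eq_zero o s t _ v]
  · rw [norm_zero]
    positivity
  · intro h
    exact hv (funext fun i => Fintype.linearIndependent_iff.1 B.linIndep _ h i)

end QuadFactor

/-- The weighted number of configurations `(a, b, c, c')` for which all the points
`a i + b j + c` and `a i + b j + c'` with `R i j` lie in `S`. -/
noncomputable def configCount {G : Type*} [AddCommGroup G] [Fintype G] (S : Set G)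
    {𝔸 𝔹 : Type*} [Fintype 𝔸] [Fintype 𝔹] [DecidableEq 𝔸]
    [DecidableEq 𝔹] (R : 𝔸 → 𝔹 → Prop) : ℝ :=
  ∑ a : 𝔸 → G, ∑ b : 𝔹 → G,
    (∑ c, ∏ i, ∏ j, if R i j then ind1 S (a i + b j + c) else 1) ^ 2

lemma ind1_eq_ite {G : Type*} (S : Set G) (x : G) : ind1 S x = if x ∈ S then 1 else 0 := by
  simp [ind1, Set.indicator_apply]

lemma prod_ite_ind1 {G : Type*} [AddCommGroup G] (S : Set G) {𝔸 𝔹 : Type*} [Fintype 𝔸]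
    [Fintype 𝔹] [DecidableEq 𝔸] [DecidableEq 𝔹] (R : 𝔸 → 𝔹 → Prop) (a : 𝔸 → G) (b : 𝔹 → G) (c : G) :
    (∏ i, ∏ j, if R i j then ind1 S (a i + b j + c) else 1) =
      if ∀ i j, R i j → a i + b j + c ∈ S then 1 else 0 := by
  split_ifs with h
  · refine Finset.prod_eq_one fun i _ => Finset.prod_eq_one fun j _ => ?_
    split_ifs with hR
    · rw [ind1_eq_ite, if_pos (h i j hR)]
    · rfl
  · push Not at h
    obtain ⟨i, j, hR, hS⟩ := h
    refine Finset.prod_eq_zero (mem_univ i) (Finset.prod_eq_zero (mem_univ j) ?_)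
    rw [if_pos hR, ind1_eq_ite, if_neg hS]

lemma configCount_eq_card {G : Type*} [AddCommGroup G] [Fintype G] (S : Set G)
    {𝔸 𝔹 : Type*} [Fintype 𝔸] [Fintype 𝔹] [DecidableEq 𝔸]
    [DecidableEq 𝔹] (R : 𝔸 → 𝔹 → Prop) :
    configCount S R = ((univ.filter fun x : ((𝔸 → G) × (𝔹 → G)) × G × G =>
      ∀ i j, R i j → x.1.1 i + x.1.2 j + x.2.1 ∈ S ∧ x.1.1 i + x.1.2 j + x.2.2 ∈ S).card : ℝ) := by
  rw [Finset.card_filter]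
  push_cast
  rw [Fintype.sum_prod_type, Fintype.sum_prod_type, configCount]
  refine Finset.sum_congr rfl fun a _ => Finset.sum_congr rfl fun b _ => ?_
  simp_rw [prod_ite_ind1]
  rw [sq, Finset.sum_mul_sum, Fintype.sum_prod_type]
  refine Finset.sum_congr rfl fun c _ => Finset.sum_congr rfl fun c' _ => ?_
  rw [mul_ite, mul_one, mul_zero, ← ite_and]
  refine if_congr ?_ rfl rfl
  simp only [forall_and, and_comm]

namespace QuadFactor

variable {p n ℓ q : ℕ}

open scoped Matrix in
/-- Three vertices of a parallelogram lie in the same atom: the fourth one does if and only if the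
sides are orthogonal. -/
lemma parallelogram_mem_atom_iff [Fact p.Prime] (hodd : Odd p) (B : QuadFactor p n ℓ q)
    (b : Label p ℓ q) (x u v : Vec p n) (h₀ : x ∈ B.atom b) (h₁ : x + u ∈ B.atom b)
    (h₂ : x + v ∈ B.atom b) : x + u + v ∈ B.atom b ↔ B.betaQ u v = 0 := by
  have h2 : (2 : ZMod p) ≠ 0 := by
    have : ((2 : ℕ) : ZMod p) ≠ 0 := by
      rw [Ne, ZMod.natCast_eq_zero_iff]
      intro h
      have := (Nat.prime_dvd_prime_iff_eq Fact.out Nat.prime_two).1 h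
      subst this
      exact absurd hodd (by decide)
    exact_mod_cast this
  rw [mem_atom_iff] at *
  have hs : ∀ j, v ⬝ᵥ B.Q j *ᵥ u = u ⬝ᵥ B.Q j *ᵥ v := fun j => by
    rw [Matrix.dotProduct_mulVec, ← Matrix.mulVec_transpose, (B.symm j).eq, dotProduct_comm]
  have hl : ∀ i, (x + u + v) ⬝ᵥ B.L i = b.1 i := fun i => by
    have e0 := h₀.1 i
    have e1 := h₁.1 i
    have e2 := h₂.1 i
    simp only [add_dotProduct] at *
    linear_combination e1 + e2 - e0
  have hq : ∀ j, (x + u + v) ⬝ᵥ B.Q j *ᵥ (x + u + v) = b.2 j + 2 * (u ⬝ᵥ B.Q j *ᵥ v) := fun j => by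
    have e0 := h₀.2 j
    have e1 := h₁.2 j
    have e2 := h₂.2 j
    rw [bilin_mixed_difference, hs j]
    linear_combination e1 + e2 - e0
  constructor
  · intro h
    funext j
    have := h.2 j
    rw [hq j] at this
    have h3 : 2 * (u ⬝ᵥ B.Q j *ᵥ v) = 0 := by linear_combination this
    exact (mul_eq_zero.1 h3).resolve_left h2
  · intro h
    refine ⟨hl, fun j => ?_⟩
    have h3 : u ⬝ᵥ B.Q j *ᵥ v = 0 := congrFun h j
    rw [hq j, h3]
    ring

end QuadFactor

/-- The change of variables expressing a configuration through its base row and column. -/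
def configEquiv {G : Type*} [AddCommGroup G] {𝔸 𝔹 : Type*} [DecidableEq 𝔹] (i₀ : 𝔸) (j₀ : 𝔹) :
    ((𝔸 → G) × (𝔹 → G)) × G × G ≃ (G × G) × (𝔸 ⊕ 𝔹 → G) where
  toFun x := ((x.1.1 i₀, x.1.2 j₀), Sum.elim (fun i => x.1.1 i + x.1.2 j₀ + x.2.1)
    (fun j => if j = j₀ then x.1.1 i₀ + x.1.2 j₀ + x.2.2 else x.1.1 i₀ + x.1.2 j + x.2.1))
  invFun y := ((fun i => y.2 (.inl i) - (y.2 (.inl i₀) - y.1.1),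
    fun j => if j = j₀ then y.1.2 else y.2 (.inr j) - y.2 (.inl i₀) + y.1.2),
    (y.2 (.inl i₀) - y.1.1 - y.1.2, y.2 (.inr j₀) - y.1.1 - y.1.2))
  left_inv x := by
    obtain ⟨⟨a, b⟩, c, c'⟩ := x
    simp only [Sum.elim_inl, Sum.elim_inr, if_true, Prod.mk.injEq]
    refine ⟨⟨?_, ?_⟩, ?_, ?_⟩
    · funext i
      abel
    · funext j
      split_ifs with h
      · rw [h]
      · abel
    · abel
    · abel
  right_inv y := by
    obtain ⟨⟨a, b⟩, z⟩ := y
    simp only [if_true, Prod.mk.injEq]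
    refine ⟨⟨by abel, trivial⟩, ?_⟩
    funext v
    rcases v with i | j
    · simp only [Sum.elim_inl]
      abel
    · simp only [Sum.elim_inr]
      split_ifs with h
      · rw [h]
        abel
      · abel

namespace QuadFactor

variable {p n ℓ q : ℕ}

lemma config_iff_system [Fact p.Prime] (hodd : Odd p) (B : QuadFactor p n ℓ q)
    (b : Label p ℓ q) {𝔸 𝔹 : Type*} [DecidableEq 𝔸] [DecidableEq 𝔹] (R : 𝔸 → 𝔹 → Prop) (i₀ : 𝔸)
        (j₀ : 𝔹)
    (hi : ∀ j, R i₀ j) (hj : ∀ i, R i j₀) (x : ((𝔸 → Vec p n) × (𝔹 → Vec p n)) × Vec p n × Vec p n)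
    (z : 𝔸 ⊕ 𝔹 → Vec p n) (hz : z = (configEquiv i₀ j₀ x).2) :
    (∀ i j, R i j → x.1.1 i + x.1.2 j + x.2.1 ∈ B.atom b ∧ x.1.1 i + x.1.2 j + x.2.2 ∈ B.atom b) ↔
    (∀ v, z v ∈ B.atom b) ∧ ∀ i j, R i j → (i, j) ≠ (i₀, j₀) →
      B.betaQ (z (if i = i₀ then .inr j₀ else .inl i) - z (.inl i₀)) (z (.inr j) - z (.inl i₀)) =
          0 := by
  obtain ⟨⟨u, v⟩, c, c'⟩ := x
  have zl : ∀ i, z (.inl i) = u i + v j₀ + c := fun i => by rw [hz]; rfl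
  have zr₀ : z (.inr j₀) = u i₀ + v j₀ + c' := by
    rw [hz]
    simp [configEquiv]
  have zr : ∀ j, j ≠ j₀ → z (.inr j) = u i₀ + v j + c := fun j h => by
    rw [hz]
    simp [configEquiv, h]
  have par := B.parallelogram_mem_atom_iff hodd b
  constructor
  · intro h
    have hv : ∀ w, z w ∈ B.atom b := by
      rintro (i | j)
      · rw [zl]
        exact (h i j₀ (hj i)).1
      · by_cases hjj : j = j₀
        · rw [hjj, zr₀]
          exact (h i₀ j₀ (hj i₀)).2
        · rw [zr j hjj]
          exact (h i₀ j (hi j)).1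
    refine ⟨hv, fun i j hR hne => ?_⟩
    refine (par (z (.inl i₀)) _ _ (hv _) (by simpa using hv _) (by simpa using hv _)).1 ?_
    by_cases hii : i = i₀
    · subst hii
      have hjj : j ≠ j₀ := fun h => hne (by rw [h])
      rw [if_pos rfl, zr₀, zr j hjj, zl]
      convert (h i j hR).2 using 1
      abel
    · rw [if_neg hii]
      by_cases hjj : j = j₀
      · subst hjj
        rw [zr₀, zl, zl]
        convert (h i j hR).2 using 1
        abel
      · rw [zr j hjj, zl, zl]
        convert (h i j hR).1 using 1
        abel
  · rintro ⟨hv, hE⟩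
    have hrow : ∀ j, u i₀ + v j + c ∈ B.atom b := fun j => by
      by_cases hjj : j = j₀
      · rw [hjj, ← zl]
        exact hv _
      · rw [← zr j hjj]
        exact hv _
    have hcol : ∀ i, u i + v j₀ + c ∈ B.atom b := fun i => by
      rw [← zl]
      exact hv _
    have hbase : u i₀ + v j₀ + c' ∈ B.atom b := by
      rw [← zr₀]
      exact hv _
    have hrow' : ∀ j, u i₀ + v j + c' ∈ B.atom b := fun j => by
      by_cases hjj : j = j₀
      · rw [hjj]
        exact hbase
      · have h := hE i₀ j (hi j) (fun h => hjj (Prod.ext_iff.1 h).2)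
        rw [if_pos rfl, zr₀, zr j hjj, zl] at h
        convert (par (u i₀ + v j₀ + c) _ _ (hcol _) ?_ ?_).2 h using 1
        · abel
        · convert hbase using 1
          abel
        · convert hrow j using 1
          abel
    have hcol' : ∀ i, u i + v j₀ + c' ∈ B.atom b := fun i => by
      by_cases hii : i = i₀
      · rw [hii]
        exact hbase
      · have h := hE i j₀ (hj i) (fun h => hii (Prod.ext_iff.1 h).1)
        rw [if_neg hii, zr₀, zl, zl] at h
        convert (par (u i₀ + v j₀ + c) _ _ (hcol _) ?_ ?_).2 h using 1
        · abel
        · convert hcol i using 1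
          abel
        · convert hbase using 1
          abel
    intro i j hR
    by_cases hii : i = i₀
    · rw [hii]
      exact ⟨hrow j, hrow' j⟩
    by_cases hjj : j = j₀
    · rw [hjj]
      exact ⟨hcol i, hcol' i⟩
    have h := hE i j hR (fun h => hii (Prod.ext_iff.1 h).1)
    rw [if_neg hii, zr j hjj, zl, zl] at h
    constructor
    · convert (par (u i₀ + v j₀ + c) _ _ (hcol _) ?_ ?_).2 h using 1
      · abel
      · convert hcol i using 1
        abel
      · convert hrow j using 1
        abel
    · convert (par (u i₀ + v j₀ + c') _ _ hbase ?_ ?_).2 h using 1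
      · abel
      · convert hcol' i using 1
        abel
      · convert hrow' j using 1
        abel

/-- Counting configurations of points in an atom of a quadratic factor of high rank. -/
lemma abs_configCount_sub_le [Fact p.Prime] (hodd : Odd p) (B : QuadFactor p n ℓ q)
    (b : Label p ℓ q) {𝔸 𝔹 : Type*} [Fintype 𝔸] [Fintype 𝔹] [DecidableEq 𝔸]
    [DecidableEq 𝔹] (R : 𝔸 → 𝔹 → Prop) (i₀ : 𝔸) (j₀ : 𝔹)
    (hi : ∀ j, R i₀ j) (hj : ∀ i, R i j₀) (N r : ℕ)
    (hN : Fintype.card 𝔸 + Fintype.card 𝔹 = N)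
    (hr : (univ.filter fun x : 𝔸 × 𝔹 => R x.1 x.2).card = r + 1)
    (e : ℝ) (he0 : 0 ≤ e) (he1 : e ≤ 1) (he : 1 ≤ e ^ 4 * (p : ℝ) ^ B.rank) :
    |configCount (B.atom b) R - ((p : ℝ) ^ n) ^ (N + 2) / (p : ℝ) ^ (N * ℓ + (N * q + r * q))| ≤
      ((p : ℝ) ^ n) ^ (N + 2) * e := by
  set E := {x : 𝔸 × 𝔹 // R x.1 x.2 ∧ x ≠ (i₀, j₀)} with hE
  have hcE : Fintype.card E = r := by
    rw [Fintype.card_subtype]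
    have : (univ.filter fun x : 𝔸 × 𝔹 => R x.1 x.2 ∧ x ≠ (i₀, j₀)) =
        (univ.filter fun x : 𝔸 × 𝔹 => R x.1 x.2).erase (i₀, j₀) := by
      ext x
      simp [and_comm]
    rw [this, Finset.card_erase_of_mem (by simpa using hi j₀), hr, Nat.add_sub_cancel]
  have hcV : Fintype.card (𝔸 ⊕ 𝔹) = N := by rw [Fintype.card_sum, hN]
  have hsys := B.card_system hodd b (Sum.inl i₀ : 𝔸 ⊕ 𝔹)
    (fun x : E => if x.1.1 = i₀ then .inr j₀ else .inl x.1.1) (fun x => .inr x.1.2)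
    (fun x => by split_ifs with h <;> simp [h]) (fun x => by simp)
    (fun x => by
      split_ifs with h
      · intro h'
        exact x.2.2 (Prod.ext h (Sum.inr_injective h').symm)
      · simp)
    (fun x y h h' => by
      have h2 := Sum.inr_injective h'
      refine Subtype.ext (Prod.ext ?_ h2)
      split_ifs at h with h3 h4 h4
      · rw [h3, h4]
      · exact Sum.inl_injective h)
    (fun x y h h' => by
      split_ifs at h
      split_ifs at h' with h4
      exact y.2.2 (Prod.ext h4 (Sum.inr_injective h).symm))
    e he0 he1 he
  rw [hcV, hcE] at hsys
  have hcount : configCount (B.atom b) R = ((p : ℝ) ^ n) ^ 2 *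
      ((univ.filter fun z : 𝔸 ⊕ 𝔹 → Vec p n => (∀ v, z v ∈ B.atom b) ∧ ∀ x : E,
        B.betaQ (z (if x.1.1 = i₀ then .inr j₀ else .inl x.1.1) - z (.inl i₀))
          (z (.inr x.1.2) - z (.inl i₀)) = 0).card : ℝ) := by
    rw [configCount_eq_card]
    have h1 : (univ.filter fun x : ((𝔸 → Vec p n) × (𝔹 → Vec p n)) × Vec p n × Vec p n =>
        ∀ i j, R i j → x.1.1 i + x.1.2 j + x.2.1 ∈ B.atom b ∧
          x.1.1 i + x.1.2 j + x.2.2 ∈ B.atom b).card =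
        ((univ : Finset (Vec p n × Vec p n)) ×ˢ univ.filter fun z : 𝔸 ⊕ 𝔹 → Vec p n =>
          (∀ v, z v ∈ B.atom b) ∧ ∀ x : E,
          B.betaQ (z (if x.1.1 = i₀ then .inr j₀ else .inl x.1.1) - z (.inl i₀))
            (z (.inr x.1.2) - z (.inl i₀)) = 0).card := by
      refine Finset.card_equiv (configEquiv i₀ j₀) fun x => ?_
      rw [mem_filter, mem_product, mem_filter, B.config_iff_system hodd b R i₀ j₀ hi hj x _ rfl]
      simp [E]
    rw [h1, Finset.card_product]
    have h2 : (univ : Finset (Vec p n × Vec p n)).card = (p ^ n) ^ 2 := by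
      simp [ZMod.card, sq]
    rw [h2]
    push_cast
    rfl
  have hg : (0 : ℝ) ≤ ((p : ℝ) ^ n) ^ 2 := by positivity
  have h3 : ((p : ℝ) ^ n) ^ (N + 2) / (p : ℝ) ^ (N * ℓ + (N * q + r * q)) =
      ((p : ℝ) ^ n) ^ 2 * (((p : ℝ) ^ n) ^ N / (p : ℝ) ^ (N * ℓ + (N * q + r * q))) := by ring
  rw [hcount, h3, ← mul_sub, abs_mul, abs_of_nonneg hg, add_comm N 2, pow_add _ 2 N, mul_assoc]
  exact mul_le_mul_of_nonneg_left hsys hg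

end QuadFactor

section GridEnergy

variable {G : Type*} [AddCommGroup G] [Fintype G]

/-- The sum over `c` of the products of the values `g i j (a i + b j + c)`. -/
def gridSum {𝔸 𝔹 : Type*} [Fintype 𝔸] [Fintype 𝔹] (g : 𝔸 → 𝔹 → G → ℝ) (a : 𝔸 → G) (b : 𝔹 → G) :
    ℝ :=
  ∑ c, ∏ i, ∏ j, g i j (a i + b j + c)

/-- The sum of the squares of the grid sums of a family of functions. -/
noncomputable def gridEnergy {𝔸 𝔹 : Type*} [Fintype 𝔸] [Fintype 𝔹] [DecidableEq 𝔸]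
    [DecidableEq 𝔹] (g : 𝔸 → 𝔹 → G → ℝ) : ℝ :=
  ∑ a : 𝔸 → G, ∑ b : 𝔹 → G, gridSum g a b ^ 2

/-- The family of functions equal to `f * ind1 S` at the places of `T` and to `ind1 S` elsewhere. -/
noncomputable def localFamily {𝔸 𝔹 : Type*} [DecidableEq 𝔸] [DecidableEq 𝔹] (S : Set G)
    (f : G → ℝ) (T : Finset (𝔸 × 𝔹)) :
    𝔸 → 𝔹 → G → ℝ :=
  fun i j x => if (i, j) ∈ T then f x * ind1 S x else ind1 S x

omit [AddCommGroup G] [Fintype G] in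
lemma ind1_nonneg (S : Set G) (x : G) : 0 ≤ ind1 S x := by
  rw [ind1_eq_ite]
  split_ifs <;> norm_num

lemma gridSum_ind1_nonneg {𝔸 𝔹 : Type*} [Fintype 𝔸] [Fintype 𝔹] (S : Set G) (a : 𝔸 → G)
    (b : 𝔹 → G) : 0 ≤ gridSum (fun _ _ => ind1 S) a b :=
  Finset.sum_nonneg fun _ _ => Finset.prod_nonneg fun _ _ => Finset.prod_nonneg fun _ _ =>
    ind1_nonneg S _

lemma abs_sum_mul_le_of_sq_le {ι : Type*} (s : Finset ι) (u v : ι → ℝ) (θ : ℝ) (hθ : 0 ≤ θ)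
    (h : ∑ i ∈ s, u i ^ 2 ≤ θ ^ 2 * ∑ i ∈ s, v i ^ 2) :
    ∑ i ∈ s, |u i| * v i ≤ θ * ∑ i ∈ s, v i ^ 2 := by
  have h0 : 0 ≤ ∑ i ∈ s, v i ^ 2 := Finset.sum_nonneg fun _ _ => sq_nonneg _
  refine le_of_sq_le_sq ?_ (by positivity)
  refine (Finset.sum_mul_sq_le_sq_mul_sq s _ _).trans ?_
  simp only [sq_abs]
  calc _ ≤ (θ ^ 2 * ∑ i ∈ s, v i ^ 2) * ∑ i ∈ s, v i ^ 2 := by gcongr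
    _ = _ := by ring

/-- If the energies of all the nontrivial local families are small, then some grid sum of the
trivial family dominates the other ones. -/
lemma exists_gridSum_gt {𝔸 𝔹 : Type*} [Fintype 𝔸] [Fintype 𝔹] [DecidableEq 𝔸]
    [DecidableEq 𝔹] (S : Set G) (f : G → ℝ)
    (w θ : Finset (𝔸 × 𝔹) → ℝ) (hw : ∀ T, 0 ≤ w T) (hθ : ∀ T, 0 ≤ θ T)
    (hpos : 0 < gridEnergy fun (_ : 𝔸) (_ : 𝔹) => ind1 S)
    (hE : ∀ T, T ≠ ∅ → gridEnergy (localFamily S f T) ≤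
      θ T ^ 2 * gridEnergy fun (_ : 𝔸) (_ : 𝔹) => ind1 S)
    (hsum : ∑ T ∈ univ.erase ∅, w T * θ T < 1) :
    ∃ a b, ∑ T ∈ univ.erase ∅, w T * |gridSum (localFamily S f T) a b| <
      gridSum (fun (_ : 𝔸) (_ : 𝔹) => ind1 S) a b := by
  by_contra! hcon
  set N : (𝔸 → G) × (𝔹 → G) → ℝ := fun x => gridSum (fun _ _ => ind1 S) x.1 x.2 with hN
  set Φ : Finset (𝔸 × 𝔹) → (𝔸 → G) × (𝔹 → G) → ℝ :=
    fun T x => gridSum (localFamily S f T) x.1 x.2 with hΦ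
  have hEN : (gridEnergy fun (_ : 𝔸) (_ : 𝔹) => ind1 S) = ∑ x, N x ^ 2 := by
    rw [gridEnergy, Fintype.sum_prod_type]
  have hEΦ : ∀ T, gridEnergy (localFamily S f T) = ∑ x, Φ T x ^ 2 := fun T => by
    rw [gridEnergy, Fintype.sum_prod_type]
  have hN0 : ∀ x, 0 ≤ N x := fun x => gridSum_ind1_nonneg S _ _
  rw [hEN] at hpos
  have h1 : ∑ x, N x ^ 2 ≤ ∑ T ∈ univ.erase ∅, w T * ∑ x, |Φ T x| * N x := by
    simp_rw [Finset.mul_sum]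
    rw [Finset.sum_comm]
    refine Finset.sum_le_sum fun x _ => ?_
    rw [sq]
    refine (mul_le_mul_of_nonneg_right (hcon x.1 x.2) (hN0 x)).trans (le_of_eq ?_)
    rw [Finset.sum_mul]
    exact Finset.sum_congr rfl fun T _ => mul_assoc _ _ _
  have h2 : ∑ T ∈ univ.erase ∅, w T * ∑ x, |Φ T x| * N x ≤
      ∑ T ∈ univ.erase ∅, w T * (θ T * ∑ x, N x ^ 2) := by
    refine Finset.sum_le_sum fun T hT => mul_le_mul_of_nonneg_left ?_ (hw T)
    refine abs_sum_mul_le_of_sq_le _ _ _ _ (hθ T) ?_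
    rw [← hEΦ, ← hEN]
    exact hE T (Finset.ne_of_mem_erase hT)
  have h3 : ∑ T ∈ univ.erase ∅, w T * (θ T * ∑ x, N x ^ 2) =
      (∑ T ∈ univ.erase ∅, w T * θ T) * ∑ x, N x ^ 2 := by
    rw [Finset.sum_mul]
    exact Finset.sum_congr rfl fun T _ => (mul_assoc _ _ _).symm
  have h4 := h1.trans (h2.trans_eq h3)
  nlinarith

/-- The expansion of the grid sums of the functions `(α + s f) ind1 S`. -/
lemma gridSum_add_eq {𝔸 𝔹 : Type*} [Fintype 𝔸] [Fintype 𝔹] [DecidableEq 𝔸]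
    [DecidableEq 𝔹] (S : Set G) (f : G → ℝ)
    (α s : 𝔸 × 𝔹 → ℝ) (a : 𝔸 → G) (b : 𝔹 → G) :
    gridSum (fun i j x => (α (i, j) + s (i, j) * f x) * ind1 S x) a b =
      ∑ T : Finset (𝔸 × 𝔹), ((∏ x ∈ T, s x) * ∏ x ∈ univ \ T, α x) *
        gridSum (localFamily S f T) a b := by
  have h : ∀ c, ∏ i, ∏ j, (α (i, j) + s (i, j) * f (a i + b j + c)) * ind1 S (a i + b j + c) =
      ∑ T : Finset (𝔸 × 𝔹), ((∏ x ∈ T, s x) * ∏ x ∈ univ \ T, α x) *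
        ∏ i, ∏ j, localFamily S f T i j (a i + b j + c) := by
    intro c
    rw [← Fintype.prod_prod_type' (f := fun i j =>
      (α (i, j) + s (i, j) * f (a i + b j + c)) * ind1 S (a i + b j + c))]
    have h1 : ∀ x : 𝔸 × 𝔹, (α x + s x * f (a x.1 + b x.2 + c)) * ind1 S (a x.1 + b x.2 + c) =
        s x * (f (a x.1 + b x.2 + c) * ind1 S (a x.1 + b x.2 + c)) +
          α x * ind1 S (a x.1 + b x.2 + c) := fun x => by ring
    simp only [h1, Prod.mk.eta]
    rw [Finset.prod_add, Finset.powerset_univ]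
    refine Finset.sum_congr rfl fun T _ => ?_
    rw [Finset.prod_mul_distrib (f := s), Finset.prod_mul_distrib (f := α),
      ← Fintype.prod_prod_type' (f := fun i j => localFamily S f T i j (a i + b j + c)),
      ← Finset.prod_sdiff (Finset.subset_univ T)]
    have h2 : ∏ x ∈ T, localFamily S f T x.1 x.2 (a x.1 + b x.2 + c) =
        ∏ x ∈ T, (f (a x.1 + b x.2 + c) * ind1 S (a x.1 + b x.2 + c)) :=
      Finset.prod_congr rfl fun x hx => if_pos hx
    have h3 : ∏ x ∈ univ \ T, localFamily S f T x.1 x.2 (a x.1 + b x.2 + c) =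
        ∏ x ∈ univ \ T, ind1 S (a x.1 + b x.2 + c) :=
      Finset.prod_congr rfl fun x hx => if_neg (Finset.mem_sdiff.1 hx).2
    rw [h2, h3]
    ring
  rw [gridSum, Finset.sum_congr rfl fun c _ => h c, Finset.sum_comm]
  refine Finset.sum_congr rfl fun T _ => ?_
  rw [gridSum, Finset.mul_sum]

lemma prod_sdiff_le_mul_prod {ι : Type*} [Fintype ι] [DecidableEq ι] (α : ι → ℝ) (ε : ℝ)
    (hε : 0 < ε)
    (hα : ∀ x, ε ≤ α x) (T : Finset ι) :
    ∏ x ∈ univ \ T, α x ≤ (∏ x, α x) * ε⁻¹ ^ T.card := by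
  have h0 : 0 ≤ ∏ x ∈ univ \ T, α x := Finset.prod_nonneg fun x _ => hε.le.trans (hα x)
  have h1 : ε ^ T.card ≤ ∏ x ∈ T, α x := by
    rw [← Finset.prod_const]
    exact Finset.prod_le_prod (fun _ _ => hε.le) fun x _ => hα x
  rw [← Finset.prod_sdiff (Finset.subset_univ T), mul_assoc, inv_pow, ← div_eq_mul_inv]
  exact le_mul_of_one_le_right h0 ((one_le_div (by positivity)).2 h1)

/-- If some grid sum dominates, then all patterns are realised by `A`. -/
lemma hasVC2Dim_of_gridEnergy_le (m : ℕ) (S A : Set G) (α ε : ℝ) (hε : 0 < ε) (hα₀ : ε ≤ α)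
    (hα₁ : α ≤ 1 - ε) (θ : Finset (Fin m × Fin m) → ℝ) (hθ : ∀ T, 0 ≤ θ T)
    (hpos : 0 < gridEnergy fun (_ : Fin m) (_ : Fin m) => ind1 S)
    (hE : ∀ T, T ≠ ∅ → gridEnergy (localFamily S (fun x => ind1 A x - α) T) ≤
      θ T ^ 2 * gridEnergy fun (_ : Fin m) (_ : Fin m) => ind1 S)
    (hsum : ∑ T ∈ univ.erase ∅, ε⁻¹ ^ T.card * θ T < 1) : HasVC2Dim A m := by
  set f : G → ℝ := fun x => ind1 A x - α with hf
  obtain ⟨a, b, hab⟩ := exists_gridSum_gt S f (fun T => ε⁻¹ ^ T.card) θ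
    (fun T => by positivity) hθ hpos hE hsum
  have key : ∀ P : Set (Fin m × Fin m), ∃ c, ∀ i j, a i + b j + c ∈ A ↔ (i, j) ∈ P := by
    intro P
    set β : Fin m × Fin m → ℝ := fun x => if x ∈ P then α else 1 - α with hβ
    set s : Fin m × Fin m → ℝ := fun x => if x ∈ P then 1 else -1 with hs
    have hβε : ∀ x, ε ≤ β x := fun x => by
      simp only [hβ]
      split_ifs <;> linarith
    have hs1 : ∀ x, |s x| = 1 := fun x => by
      simp only [hs]
      split_ifs <;> simp
    have hβ0 : 0 < ∏ x, β x := Finset.prod_pos fun x _ => hε.trans_le (hβε x)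
    have h1 := gridSum_add_eq S f β s a b
    rw [← Finset.add_sum_erase _ _ (mem_univ ∅)] at h1
    have h2 : localFamily S f ∅ = fun (_ : Fin m) (_ : Fin m) => ind1 S := by
      funext i j x
      simp [localFamily]
    rw [h2, Finset.prod_empty, Finset.sdiff_empty, one_mul] at h1
    have h3 : -∑ T ∈ univ.erase ∅, (∏ x, β x) *
          (ε⁻¹ ^ T.card * |gridSum (localFamily S f T) a b|) ≤
        ∑ T ∈ univ.erase ∅, ((∏ x ∈ T, s x) * ∏ x ∈ univ \ T, β x) *
          gridSum (localFamily S f T) a b := by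
      refine neg_le_of_abs_le ((Finset.abs_sum_le_sum_abs _ _).trans ?_)
      refine Finset.sum_le_sum fun T _ => ?_
      rw [abs_mul, abs_mul, Finset.abs_prod, Finset.prod_congr rfl fun x _ => hs1 x,
        Finset.prod_const_one, one_mul, ← mul_assoc, abs_of_nonneg
          (Finset.prod_nonneg fun x _ => hε.le.trans (hβε x))]
      exact mul_le_mul_of_nonneg_right (prod_sdiff_le_mul_prod β ε hε hβε T) (abs_nonneg _)
    rw [← Finset.mul_sum] at h3
    have h4 := mul_lt_mul_of_pos_left hab hβ0
    have h5 : gridSum (fun i j x => (β (i, j) + s (i, j) * f x) * ind1 S x) a b ≠ 0 := by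
      rw [h1]
      intro h
      linarith
    obtain ⟨c, -, hc⟩ := Finset.exists_ne_zero_of_sum_ne_zero h5
    refine ⟨c, fun i j => ?_⟩
    have h6 := Finset.prod_ne_zero_iff.1 (Finset.prod_ne_zero_iff.1 hc i (mem_univ i)) j
        (mem_univ j)
    have h7 := left_ne_zero_of_mul h6
    simp only [hβ, hs, hf, ind1_eq_ite] at h7
    by_cases hP : (i, j) ∈ P <;> by_cases hA : a i + b j + c ∈ A <;> simp_all
  choose c hc using key
  exact ⟨a, b, c, fun i j P => hc P i j⟩

end GridEnergy

section BoxEnergy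

variable {G : Type*} [AddCommGroup G] [Fintype G]

/-- The energy of a two by two family of functions. -/
noncomputable def boxEnergy (g₀₀ g₀₁ g₁₀ g₁₁ : G → ℝ) : ℝ :=
  ∑ a₀, ∑ a₁, ∑ b₀, ∑ b₁,
    (∑ c, g₀₀ (a₀ + b₀ + c) * g₀₁ (a₀ + b₁ + c) * (g₁₀ (a₁ + b₀ + c) * g₁₁ (a₁ + b₁ + c))) ^ 2

lemma boxEnergy_nonneg (g₀₀ g₀₁ g₁₀ g₁₁ : G → ℝ) : 0 ≤ boxEnergy g₀₀ g₀₁ g₁₀ g₁₁ :=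
  Finset.sum_nonneg fun _ _ => Finset.sum_nonneg fun _ _ => Finset.sum_nonneg fun _ _ =>
    Finset.sum_nonneg fun _ _ => sq_nonneg _

omit [AddCommGroup G] in
lemma sum_sum_comm_pairs (X : G → G → G → G → ℝ) :
    ∑ a₀, ∑ a₁, ∑ b₀, ∑ b₁, X a₀ a₁ b₀ b₁ = ∑ b₀, ∑ b₁, ∑ a₀, ∑ a₁, X a₀ a₁ b₀ b₁ := by
  simp only [← Fintype.sum_prod_type']
  exact Fintype.sum_equiv ⟨fun x => (x.2.2.1, x.2.2.2, x.1, x.2.1),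
    fun x => (x.2.2.1, x.2.2.2, x.1, x.2.1), fun _ => rfl, fun _ => rfl⟩ _ _ (fun _ => rfl)

lemma boxEnergy_transpose (g₀₀ g₀₁ g₁₀ g₁₁ : G → ℝ) :
    boxEnergy g₀₀ g₀₁ g₁₀ g₁₁ = boxEnergy g₀₀ g₁₀ g₀₁ g₁₁ := by
  rw [boxEnergy, sum_sum_comm_pairs, boxEnergy]
  refine Finset.sum_congr rfl fun b₀ _ => Finset.sum_congr rfl fun b₁ _ =>
    Finset.sum_congr rfl fun a₀ _ => Finset.sum_congr rfl fun a₁ _ => ?_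
  congr 1
  refine Finset.sum_congr rfl fun c _ => ?_
  rw [add_comm a₀ b₀, add_comm a₀ b₁, add_comm a₁ b₀, add_comm a₁ b₁]
  ring

/-- The inner sum occurring in the energy after expanding the square. -/
def rowSum (g₀ g₁ : G → ℝ) (b₀ b₁ c c' : G) : ℝ :=
  ∑ a, g₀ (a + b₀ + c) * g₁ (a + b₁ + c) * (g₀ (a + b₀ + c') * g₁ (a + b₁ + c'))

lemma boxEnergy_eq_sum_rowSum (g₀₀ g₀₁ g₁₀ g₁₁ : G → ℝ) :
    boxEnergy g₀₀ g₀₁ g₁₀ g₁₁ = ∑ y : G × G × G × G,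
      rowSum g₀₀ g₀₁ y.1 y.2.1 y.2.2.1 y.2.2.2 * rowSum g₁₀ g₁₁ y.1 y.2.1 y.2.2.1 y.2.2.2 := by
  simp only [boxEnergy, rowSum, sq, Finset.sum_mul_sum]
  simp only [← Fintype.sum_prod_type']
  refine Fintype.sum_equiv ⟨fun x => ((x.2.2.1, x.2.2.2.1, x.2.2.2.2.1, x.2.2.2.2.2), x.1, x.2.1),
      fun x => (x.2.1, x.2.2, x.1.1, x.1.2.1, x.1.2.2.1, x.1.2.2.2),
      fun _ => rfl, fun _ => rfl⟩ _ _ (fun x => ?_)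
  simp only [Equiv.coe_fn_mk]
  ring

lemma boxEnergy_sq_le (g₀₀ g₀₁ g₁₀ g₁₁ : G → ℝ) :
    boxEnergy g₀₀ g₀₁ g₁₀ g₁₁ ^ 2 ≤
      boxEnergy g₀₀ g₀₁ g₀₀ g₀₁ * boxEnergy g₁₀ g₁₁ g₁₀ g₁₁ := by
  simp only [boxEnergy_eq_sum_rowSum, ← sq]
  exact Finset.sum_mul_sq_le_sq_mul_sq _ _ _

lemma boxEnergy_pow_four_le (g₀₀ g₀₁ g₁₀ g₁₁ : G → ℝ) :
    boxEnergy g₀₀ g₀₁ g₁₀ g₁₁ ^ 4 ≤ boxEnergy g₀₀ g₀₀ g₀₀ g₀₀ * boxEnergy g₀₁ g₀₁ g₀₁ g₀₁ *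
      (boxEnergy g₁₀ g₁₀ g₁₀ g₁₀ * boxEnergy g₁₁ g₁₁ g₁₁ g₁₁) := by
  have h (g₀ g₁ : G → ℝ) :
      boxEnergy g₀ g₁ g₀ g₁ ^ 2 ≤ boxEnergy g₀ g₀ g₀ g₀ * boxEnergy g₁ g₁ g₁ g₁ := by
    rw [boxEnergy_transpose]
    exact boxEnergy_sq_le g₀ g₀ g₁ g₁
  calc boxEnergy g₀₀ g₀₁ g₁₀ g₁₁ ^ 4 = (boxEnergy g₀₀ g₀₁ g₁₀ g₁₁ ^ 2) ^ 2 := by ring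
    _ ≤ (boxEnergy g₀₀ g₀₁ g₀₀ g₀₁ * boxEnergy g₁₀ g₁₁ g₁₀ g₁₁) ^ 2 :=
      pow_le_pow_left₀ (sq_nonneg _) (boxEnergy_sq_le _ _ _ _) 2
    _ = boxEnergy g₀₀ g₀₁ g₀₀ g₀₁ ^ 2 * boxEnergy g₁₀ g₁₁ g₁₀ g₁₁ ^ 2 := by ring
    _ ≤ _ := mul_le_mul (h _ _) (h _ _) (sq_nonneg _)
      (mul_nonneg (boxEnergy_nonneg _ _ _ _) (boxEnergy_nonneg _ _ _ _))

lemma boxEnergy_self_eq_U3pow8 (f : G → ℝ) :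
    boxEnergy f f f f = (Fintype.card G : ℝ) ^ 2 * U3pow8 f := by
  have h : boxEnergy f f f f = ∑ x : (G × G) × G × G × G × G,
      cubeProd f x.2.1 x.2.2.1 x.2.2.2.1 x.2.2.2.2 := by
    simp only [boxEnergy, sq, Finset.sum_mul_sum]
    simp only [← Fintype.sum_prod_type']
    refine Fintype.sum_equiv ⟨fun x => ((x.1, x.2.2.1), x.1 + x.2.2.1 + x.2.2.2.2.1,
      x.2.1 - x.1, x.2.2.2.1 - x.2.2.1, x.2.2.2.2.2 - x.2.2.2.2.1),
      fun y => (y.1.1, y.2.2.1 + y.1.1, y.1.2, y.2.2.2.1 + y.1.2, y.2.1 - y.1.1 - y.1.2,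
        y.2.2.2.2 + (y.2.1 - y.1.1 - y.1.2)), fun x => ?_, fun y => ?_⟩ _ _ (fun x => ?_)
    · obtain ⟨a, a', b, b', c, c'⟩ := x
      have e : a + b + c - a - b = c := by abel
      simp only [e, sub_add_cancel]
    · obtain ⟨⟨a, b⟩, x, h₁, h₂, h₃⟩ := y
      have e : a + b + (x - a - b) = x := by abel
      simp only [e, add_sub_cancel_right]
    · obtain ⟨a, a', b, b', c, c'⟩ := x
      simp only [Equiv.coe_fn_mk, cubeProd]
      have e1 : a + b + c + (a' - a) = a' + b + c := by abel
      have e2 : a + b + c + (b' - b) = a + b' + c := by abel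
      have e3 : a + b + c + (c' - c) = a + b + c' := by abel
      have e4 : a' + b + c + (b' - b) = a' + b' + c := by abel
      have e5 : a' + b + c + (c' - c) = a' + b + c' := by abel
      have e6 : a + b' + c + (c' - c) = a + b' + c' := by abel
      have e7 : a' + b' + c + (c' - c) = a' + b' + c' := by abel
      simp only [e1, e2, e3, e4, e5, e6, e7]
      ring
  rw [h, Fintype.sum_prod_type]
  simp [U3pow8, Fintype.sum_prod_type, sq]

lemma U3pow8_nonneg [Nonempty G] (f : G → ℝ) : 0 ≤ U3pow8 f := by
  have h := boxEnergy_nonneg f f f f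
  rw [boxEnergy_self_eq_U3pow8] at h
  have hG : (0 : ℝ) < (Fintype.card G : ℝ) ^ 2 := by
    have := Fintype.card_pos (α := G)
    positivity
  exact nonneg_of_mul_nonneg_right h hG

lemma U3pow8_ind1_pos (S : Set G) (hS : S.Nonempty) : 0 < U3pow8 (ind1 S) := by
  obtain ⟨x, hx⟩ := hS
  have h0 : ∀ y h₁ h₂ h₃, 0 ≤ cubeProd (ind1 S) y h₁ h₂ h₃ := fun y h₁ h₂ h₃ => by
    unfold cubeProd
    apply_rules [mul_nonneg, ind1_nonneg]
  have h1 : cubeProd (ind1 S) x 0 0 0 = 1 := by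
    simp [cubeProd, ind1_eq_ite, hx]
  have h2 : U3pow8 (ind1 S) = ∑ y : G × G × G × G,
      cubeProd (ind1 S) y.1 y.2.1 y.2.2.1 y.2.2.2 := by
    simp only [U3pow8, Fintype.sum_prod_type]
  rw [h2]
  refine Finset.sum_pos' (fun y _ => h0 _ _ _ _) ⟨(x, 0, 0, 0), mem_univ _, ?_⟩
  rw [h1]
  exact one_pos

/-- Smallness of the local norm in terms of the eighth powers. -/
lemma U3pow8_le_of_U3localP_lt (f : G → ℝ) (S : Set G) (hS : S.Nonempty) (δ : ℝ)
    (h : U3localP f S < δ) :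
    U3pow8 (fun x => f x * ind1 S x) ≤ δ ^ 8 * U3pow8 (ind1 S) := by
  have hG : Nonempty G := ⟨hS.some⟩
  have h1 := U3pow8_ind1_pos S hS
  have h2 := U3pow8_nonneg (fun x => f x * ind1 S x)
  have h3 : 0 < U3norm (ind1 S) := Real.rpow_pos_of_pos h1 _
  have h4 : ∀ g : G → ℝ, 0 ≤ U3pow8 g → U3norm g ^ 8 = U3pow8 g := fun g hg => by
    rw [U3norm, ← Real.rpow_natCast, ← Real.rpow_mul hg]
    norm_num
  rw [U3localP, div_lt_iff₀ h3] at h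
  rw [← h4 _ h2, ← h4 _ h1.le, ← mul_pow]
  exact pow_le_pow_left₀ (Real.rpow_nonneg h2 _) h.le 8

lemma gridEnergy_fin_two (g : Fin 2 → Fin 2 → G → ℝ) :
    gridEnergy g = boxEnergy (g 0 0) (g 0 1) (g 1 0) (g 1 1) := by
  have h : ∀ X : (Fin 2 → G) → ℝ, ∑ a, X a = ∑ x, ∑ y, X ![x, y] := fun X => by
    rw [← Fintype.sum_prod_type']
    exact Fintype.sum_equiv (finTwoArrowEquiv G) _ _ fun a => by
      congr 1
      ext i
      fin_cases i <;> rfl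
  simp only [gridEnergy, gridSum, h, boxEnergy, Fin.prod_univ_two, Matrix.cons_val_zero,
    Matrix.cons_val_one]

end BoxEnergy

section TwoByTwo

variable {G : Type*} [AddCommGroup G] [Fintype G]

lemma gridEnergy_localFamily_fin_two_le (S : Set G) (f : G → ℝ) (δ : ℝ)
    (h : U3pow8 (fun x => f x * ind1 S x) ≤ δ ^ 8 * U3pow8 (ind1 S))
    (T : Finset (Fin 2 × Fin 2)) :
    gridEnergy (localFamily S f T) ≤
      (δ ^ T.card) ^ 2 * gridEnergy fun (_ : Fin 2) (_ : Fin 2) => ind1 S := by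
  set C := gridEnergy fun (_ : Fin 2) (_ : Fin 2) => ind1 S with hC
  rw [gridEnergy_fin_two] at hC
  have hC0 : 0 ≤ C := hC ▸ boxEnergy_nonneg _ _ _ _
  set g := localFamily S f T with hg
  have h1 : ∀ x : Fin 2 × Fin 2, boxEnergy (g x.1 x.2) (g x.1 x.2) (g x.1 x.2) (g x.1 x.2) ≤
      (if x ∈ T then δ ^ 8 else 1) * C := by
    intro x
    rw [boxEnergy_self_eq_U3pow8]
    by_cases hx : x ∈ T
    · have : g x.1 x.2 = fun y => f y * ind1 S y := by
        funext y
        exact if_pos hx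
      rw [this, if_pos hx, hC, boxEnergy_self_eq_U3pow8]
      calc _ ≤ (Fintype.card G : ℝ) ^ 2 * (δ ^ 8 * U3pow8 (ind1 S)) := by gcongr
        _ = _ := by ring
    · have : g x.1 x.2 = ind1 S := by
        funext y
        exact if_neg hx
      rw [this, if_neg hx, hC, boxEnergy_self_eq_U3pow8, one_mul]
  have h2 : gridEnergy g ^ 4 ≤ ∏ x : Fin 2 × Fin 2,
      boxEnergy (g x.1 x.2) (g x.1 x.2) (g x.1 x.2) (g x.1 x.2) := by
    rw [gridEnergy_fin_two, Fintype.prod_prod_type]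
    simp only [Fin.prod_univ_two]
    exact boxEnergy_pow_four_le _ _ _ _
  have h3 : ∏ x : Fin 2 × Fin 2, (if x ∈ T then δ ^ 8 else 1) * C =
      ((δ ^ T.card) ^ 2 * C) ^ 4 := by
    rw [Finset.prod_mul_distrib, Finset.prod_ite_mem, Finset.univ_inter, Finset.prod_const,
      Finset.prod_const]
    simp only [Finset.card_univ, Fintype.card_prod, Fintype.card_fin]
    ring
  refine le_of_pow_le_pow_left₀ (n := 4) (by norm_num) (by positivity) (h2.trans ?_)
  rw [← h3]
  exact Finset.prod_le_prod (fun x _ => boxEnergy_nonneg _ _ _ _) fun x _ => h1 x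

lemma gridEnergy_ind1_fin_two_pos (S : Set G) (hS : S.Nonempty) :
    0 < gridEnergy fun (_ : Fin 2) (_ : Fin 2) => ind1 S := by
  have : Nonempty G := ⟨hS.some⟩
  have h := Fintype.card_pos (α := G)
  have h1 := U3pow8_ind1_pos S hS
  rw [gridEnergy_fin_two, boxEnergy_self_eq_U3pow8]
  positivity

lemma hasVC2Dim_two_of_U3pow8_le (S A : Set G) (hS : S.Nonempty) (α ε : ℝ) (hε : 0 < ε)
    (hε₁ : ε < 1 / 11) (hα₀ : ε ≤ α) (hα₁ : α ≤ 1 - ε)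
    (h : U3pow8 (fun x => (ind1 A x - α) * ind1 S x) ≤ (ε ^ 2 / 32) ^ 8 * U3pow8 (ind1 S)) :
    HasVC2Dim A 2 := by
  refine hasVC2Dim_of_gridEnergy_le 2 S A α ε hε hα₀ hα₁ (fun T => (ε ^ 2 / 32) ^ T.card)
    (fun T => by positivity) (gridEnergy_ind1_fin_two_pos S hS)
    (fun T _ => gridEnergy_localFamily_fin_two_le S _ _ h T) ?_
  have h1 : ∀ T ∈ (univ : Finset (Finset (Fin 2 × Fin 2))).erase ∅,
      ε⁻¹ ^ T.card * (ε ^ 2 / 32) ^ T.card ≤ ε / 32 := by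
    intro T hT
    have hT' : T.card ≠ 0 := Finset.card_ne_zero.2
      (Finset.nonempty_iff_ne_empty.2 (Finset.ne_of_mem_erase hT))
    have h2 : ε⁻¹ * (ε ^ 2 / 32) = ε / 32 := by field_simp
    rw [← mul_pow, h2]
    exact pow_le_of_le_one (by positivity) (by linarith) hT'
  refine (Finset.sum_le_card_nsmul _ _ _ h1).trans_lt ?_
  have h3 : ((univ : Finset (Finset (Fin 2 × Fin 2))).erase ∅).card = 15 := by
    rw [Finset.card_erase_of_mem (mem_univ _)]
    simp
  rw [h3, nsmul_eq_mul]
  push_cast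
  linarith

end TwoByTwo

section WeightedBox

/-- The Cauchy–Schwarz inequality for a sum dominated by a nonnegative weight. -/
lemma sq_sum_mul_le_of_abs_le {ι : Type*} (s : Finset ι) (u v w : ι → ℝ)
    (h : ∀ i ∈ s, |u i| ≤ w i) :
    (∑ i ∈ s, u i * v i) ^ 2 ≤ (∑ i ∈ s, w i) * ∑ i ∈ s, w i * v i ^ 2 := by
  have h0 : ∀ i ∈ s, 0 ≤ w i := fun i hi => (abs_nonneg _).trans (h i hi)
  refine Finset.sum_sq_le_sum_mul_sum_of_sq_le_mul s h0
    (fun i hi => mul_nonneg (h0 i hi) (sq_nonneg _)) fun i hi => ?_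
  have h1 : u i ^ 2 ≤ w i ^ 2 := sq_le_sq' (neg_le_of_abs_le (h i hi)) (le_of_abs_le (h i hi))
  calc (u i * v i) ^ 2 = u i ^ 2 * v i ^ 2 := by ring
    _ ≤ w i ^ 2 * v i ^ 2 := by gcongr
    _ = _ := by ring

variable {Y G : Type*} [Fintype Y] [Fintype G]

/-- A weighted box norm inequality: functions of `a, c` or `b, c` or `c` only, dominated by
weights, can be replaced by these weights. -/
lemma weighted_box_pow_four_le (F : G → G → G → ℝ) (P P' Q Q' : Y → G → G → ℝ) (R R' : Y → G → ℝ)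
    (hP : ∀ y a c, |P y a c| ≤ P' y a c) (hQ : ∀ y b c, |Q y b c| ≤ Q' y b c)
    (hR : ∀ y c, |R y c| ≤ R' y c) :
    (∑ y, ∑ a, ∑ b, (∑ c, F a b c * (P y a c * Q y b c * R y c)) ^ 2) ^ 4 ≤
      (∑ y, ∑ a, (∑ c, P' y a c * R' y c) ^ 2) ^ 2 *
        (∑ y, ∑ b, ∑ b', (∑ c, Q' y b c * Q' y b' c * R' y c) ^ 2) *
          ∑ y, ∑ a, ∑ a', ∑ b, ∑ b', (∑ c, F a b c * F a b' c * (F a' b c * F a' b' c) *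
            (P' y a c * P' y a' c * (Q' y b c * Q' y b' c) * R' y c)) ^ 2 := by
  have hP0 : ∀ y a c, 0 ≤ P' y a c := fun y a c => (abs_nonneg _).trans (hP y a c)
  have hQ0 : ∀ y b c, 0 ≤ Q' y b c := fun y b c => (abs_nonneg _).trans (hQ y b c)
  have hR0 : ∀ y c, 0 ≤ R' y c := fun y c => (abs_nonneg _).trans (hR y c)
  set E := ∑ y, ∑ a, ∑ b, (∑ c, F a b c * (P y a c * Q y b c * R y c)) ^ 2 with hE
  set X₁ := ∑ y, ∑ a, (∑ c, P' y a c * R' y c) ^ 2 with hX₁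
  set X₂ := ∑ y, ∑ b, ∑ b', (∑ c, Q' y b c * Q' y b' c * R' y c) ^ 2 with hX₂
  set u : Y × G × G × G → ℝ := fun ⟨y, a, c, c'⟩ => P y a c * P y a c' * (R y c * R y c') with hu
  set w : Y × G × G × G → ℝ :=
    fun ⟨y, a, c, c'⟩ => P' y a c * P' y a c' * (R' y c * R' y c') with hw
  set v : Y × G × G × G → ℝ :=
    fun ⟨y, a, c, c'⟩ => ∑ b, F a b c * F a b c' * (Q y b c * Q y b c') with hv
  set u₂ : Y × G × G × G × G → ℝ := fun ⟨y, b, b', c, c'⟩ =>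
    Q y b c * Q y b c' * (Q y b' c * Q y b' c') * (R' y c * R' y c') with hu₂
  set w₂ : Y × G × G × G × G → ℝ := fun ⟨y, b, b', c, c'⟩ =>
    Q' y b c * Q' y b c' * (Q' y b' c * Q' y b' c') * (R' y c * R' y c') with hw₂
  set v₂ : Y × G × G × G × G → ℝ := fun ⟨y, b, b', c, c'⟩ => ∑ a, P' y a c * P' y a c' *
    (F a b c * F a b c' * (F a b' c * F a b' c')) with hv₂
  have h1 : E = ∑ z, u z * v z := by
    simp only [hE, hu, hv, sq, Finset.sum_mul_sum, Fintype.sum_prod_type]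
    simp only [Finset.mul_sum]
    refine Finset.sum_congr rfl fun y _ => Finset.sum_congr rfl fun a _ => ?_
    rw [Finset.sum_comm]
    refine Finset.sum_congr rfl fun c _ => ?_
    rw [Finset.sum_comm]
    refine Finset.sum_congr rfl fun c' _ => Finset.sum_congr rfl fun b _ => ?_
    ring
  have h2 : X₁ = ∑ z, w z := by
    simp only [hX₁, hw, sq, Finset.sum_mul_sum, Fintype.sum_prod_type]
    refine Finset.sum_congr rfl fun y _ => Finset.sum_congr rfl fun a _ =>
      Finset.sum_congr rfl fun c _ => Finset.sum_congr rfl fun c' _ => ?_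
    ring
  have h3 : ∑ z, w z * v z ^ 2 = ∑ z, u₂ z * v₂ z := by
    simp only [hw, hv, hu₂, hv₂, sq, Finset.sum_mul_sum]
    simp only [Finset.mul_sum]
    simp only [Fintype.sum_prod_type]
    refine Finset.sum_congr rfl fun y _ => ?_
    simp only [← Fintype.sum_prod_type']
    refine Fintype.sum_equiv ⟨fun x => (x.2.2.2.1, x.2.2.2.2, x.2.1, x.2.2.1, x.1),
      fun x => (x.2.2.2.2, x.2.2.1, x.2.2.2.1, x.1, x.2.1),
      fun _ => rfl, fun _ => rfl⟩ _ _ (fun x => ?_)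
    simp only [Equiv.coe_fn_mk]
    ring
  have h4 : X₂ = ∑ z, w₂ z := by
    simp only [hX₂, hw₂, sq, Finset.sum_mul_sum, Fintype.sum_prod_type]
    refine Finset.sum_congr rfl fun y _ => Finset.sum_congr rfl fun b _ =>
      Finset.sum_congr rfl fun b' _ => Finset.sum_congr rfl fun c _ =>
      Finset.sum_congr rfl fun c' _ => ?_
    ring
  have h5 : ∑ y, ∑ a, ∑ a', ∑ b, ∑ b', (∑ c, F a b c * F a b' c * (F a' b c * F a' b' c) *
      (P' y a c * P' y a' c * (Q' y b c * Q' y b' c) * R' y c)) ^ 2 = ∑ z, w₂ z * v₂ z ^ 2 := by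
    simp only [hw₂, hv₂, sq, Finset.sum_mul_sum]
    simp only [Finset.mul_sum]
    simp only [Fintype.sum_prod_type]
    refine Finset.sum_congr rfl fun y _ => ?_
    simp only [← Fintype.sum_prod_type']
    refine Fintype.sum_equiv ⟨fun x => (x.2.2.1, x.2.2.2.1, x.2.2.2.2.1, x.2.2.2.2.2, x.1, x.2.1),
      fun x => (x.2.2.2.2.1, x.2.2.2.2.2, x.1, x.2.1, x.2.2.1, x.2.2.2.1),
      fun _ => rfl, fun _ => rfl⟩ _ _ (fun x => ?_)
    simp only [Equiv.coe_fn_mk]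
    ring
  have h6 : E ^ 2 ≤ X₁ * ∑ z, u₂ z * v₂ z := by
    rw [h1, h2, ← h3]
    refine sq_sum_mul_le_of_abs_le _ _ _ _ fun ⟨y, a, c, c'⟩ _ => ?_
    simp only [hu, hw, abs_mul]
    have := hP y a c; have := hP y a c'; have := hR y c; have := hR y c'
    have := hP0 y a c; have := hP0 y a c'; have := hR0 y c
    gcongr
  have h7 : (∑ z, u₂ z * v₂ z) ^ 2 ≤ X₂ * ∑ z, w₂ z * v₂ z ^ 2 := by
    rw [h4]
    refine sq_sum_mul_le_of_abs_le _ _ _ _ fun ⟨y, b, b', c, c'⟩ _ => ?_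
    simp only [hu₂, hw₂, abs_mul, abs_of_nonneg (hR0 _ _)]
    have := hQ y b c; have := hQ y b c'; have := hQ y b' c; have := hQ y b' c'
    have := hQ0 y b c; have := hQ0 y b c'; have := hQ0 y b' c; have := hR0 y c; have := hR0 y c'
    gcongr
  rw [h5]
  calc E ^ 4 = (E ^ 2) ^ 2 := by ring
    _ ≤ (X₁ * ∑ z, u₂ z * v₂ z) ^ 2 := by gcongr
    _ = X₁ ^ 2 * (∑ z, u₂ z * v₂ z) ^ 2 := by ring
    _ ≤ X₁ ^ 2 * (X₂ * ∑ z, w₂ z * v₂ z ^ 2) := by gcongr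
    _ = _ := by ring

end WeightedBox

section OptionGrid

variable {G : Type*} [AddCommGroup G] [Fintype G] {κ : Type*} [Fintype κ] [DecidableEq κ]

omit [AddCommGroup G] in
lemma sum_option_arrow (φ : (Option κ → G) → ℝ) :
    ∑ a, φ a = ∑ x, ∑ a, φ (fun o => o.elim x a) := by
  rw [← Fintype.sum_prod_type']
  exact (Fintype.sum_equiv (Equiv.piOptionEquivProd (β := fun _ : Option κ => G)).symm _ _
    fun x => congrArg φ (funext fun o => by cases o <;> rfl)).symm

omit [AddCommGroup G] in
lemma sum_sum_arrow {κ' : Type*} [Fintype κ'] [DecidableEq κ'] (φ : (κ ⊕ κ' → G) → ℝ) :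
    ∑ a, φ a = ∑ a, ∑ a', φ (Sum.elim a a') := by
  rw [← Fintype.sum_prod_type']
  exact (Fintype.sum_equiv (Equiv.sumArrowEquivProdArrow κ κ' G).symm _ _ fun x => rfl).symm

omit [AddCommGroup G] in
lemma sum_insertNth {k : ℕ} (i : Fin (k + 1)) (φ : (Fin (k + 1) → G) → ℝ) :
    ∑ a, φ a = ∑ x, ∑ a, φ (i.insertNth x a) := by
  rw [← Fintype.sum_prod_type']
  exact (Fintype.sum_equiv (Fin.insertNthEquiv (fun _ => G) i) _ _ fun x => rfl).symm

/-- The product of `f` over the four points of a box. -/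
noncomputable def boxProd (f : G → ℝ) (a a' b b' c : G) : ℝ :=
  f (a + b + c) * f (a + b' + c) * (f (a' + b + c) * f (a' + b' + c))

/-- The indicator function of the event that all the points of a grid lie in `S`. -/
noncomputable def gridInd {𝔸 𝔹 : Type*} [Fintype 𝔸] [Fintype 𝔹] (S : Set G) (a : 𝔸 → G) (b : 𝔹 → G)
    (c : G) : ℝ :=
  ∏ i, ∏ j, ind1 S (a i + b j + c)

/-- Prepend two values to a family. -/
def consTwo (x x' : G) (a : κ → G) : Option (Option κ) → G :=
  fun o => o.elim x fun o' => o'.elim x' a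

lemma gridEnergy_ind1_eq {𝔸 𝔹 : Type*} [Fintype 𝔸] [Fintype 𝔹] [DecidableEq 𝔸]
    [DecidableEq 𝔹] (S : Set G) : (gridEnergy fun (_ : 𝔸) (_ : 𝔹) => ind1 S) =
      ∑ a : 𝔸 → G, ∑ b : 𝔹 → G, (∑ c, gridInd S a b c) ^ 2 := rfl

lemma gridEnergy_ind1_eq_configCount {𝔸 𝔹 : Type*} [Fintype 𝔸] [Fintype 𝔹] [DecidableEq 𝔸]
    [DecidableEq 𝔹] (S : Set G) : (gridEnergy fun (_ : 𝔸) (_ : 𝔹) => ind1 S) =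
      configCount S fun (_ : 𝔸) (_ : 𝔹) => True := by
  simp [configCount, gridEnergy, gridSum]

omit [Fintype G] [DecidableEq κ] in
lemma gridInd_option_left {𝔹 : Type*} [Fintype 𝔹] (S : Set G) (x : G) (a : κ → G) (b : 𝔹 → G)
    (c : G) : gridInd S (fun o : Option κ => o.elim x a) b c =
      (∏ j, ind1 S (x + b j + c)) * gridInd S a b c := by
  simp [gridInd, Fintype.prod_option]

omit [Fintype G] [DecidableEq κ] in
lemma gridInd_option_right {𝔸 : Type*} [Fintype 𝔸] (S : Set G) (x : G) (a : 𝔸 → G) (b : κ → G)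
    (c : G) : gridInd S a (fun o : Option κ => o.elim x b) c =
      (∏ i, ind1 S (a i + x + c)) * gridInd S a b c := by
  simp [gridInd, Fintype.prod_option, Finset.prod_mul_distrib]

omit [Fintype G] [DecidableEq κ] in
lemma gridInd_consTwo {κ' : Type*} [Fintype κ'] (S : Set G) (x x' y y' : G) (a : κ → G)
    (b : κ' → G) (c : G) : gridInd S (consTwo x x' a) (consTwo y y' b) c =
      boxProd (ind1 S) x x' y y' c * ((∏ j, ind1 S (x + b j + c)) * (∏ j, ind1 S (x' + b j + c)) *
        ((∏ i, ind1 S (a i + y + c)) * ∏ i, ind1 S (a i + y' + c)) * gridInd S a b c) := by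
  unfold consTwo
  simp only [gridInd_option_left, gridInd_option_right, Fintype.prod_option,
    Option.elim_none, Option.elim_some, boxProd]
  ring

lemma sum_gridInd_option_sq (S : Set G) :
    ∑ y : (κ → G) × (κ → G), ∑ a, (∑ c, (∏ j, ind1 S (a + y.2 j + c)) * gridInd S y.1 y.2 c) ^ 2 =
      gridEnergy fun (_ : Option κ) (_ : κ) => ind1 S := by
  simp only [gridEnergy_ind1_eq, sum_option_arrow, gridInd_option_left]
  simp only [← Fintype.sum_prod_type']
  refine Fintype.sum_equiv ⟨fun x => (x.2, x.1.1, x.1.2), fun x => ((x.2.1, x.2.2), x.1),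
    fun _ => rfl, fun _ => rfl⟩ _ _ (fun x => ?_)
  rfl

lemma sum_gridInd_option_option_sq (S : Set G) :
    ∑ y : (κ → G) × (κ → G), ∑ b, ∑ b', (∑ c, (∏ i, ind1 S (y.1 i + b + c)) *
        (∏ i, ind1 S (y.1 i + b' + c)) * gridInd S y.1 y.2 c) ^ 2 =
      gridEnergy fun (_ : κ) (_ : Option (Option κ)) => ind1 S := by
  simp only [gridEnergy_ind1_eq, sum_option_arrow, gridInd_option_right, ← mul_assoc]
  simp only [← Fintype.sum_prod_type']
  refine Fintype.sum_equiv ⟨fun x => (x.1.1, x.2.1, x.2.2, x.1.2),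
    fun x => ((x.1, x.2.2.2), x.2.1, x.2.2.1), fun _ => rfl, fun _ => rfl⟩ _ _ (fun x => ?_)
  rfl

/-- The number of extensions of a cube to a pair of grids contained in `S`. -/
noncomputable def extensionCount (κ : Type*) [Fintype κ] [DecidableEq κ] (S : Set G)
    (t : (G × G × G × G) × G × G) : ℝ :=
  ∑ y : (κ → G) × (κ → G), gridInd S (consTwo t.1.1 t.1.2.1 y.1)
    (consTwo t.1.2.2.1 t.1.2.2.2 y.2) t.2.1 * gridInd S (consTwo t.1.1 t.1.2.1 y.1)
    (consTwo t.1.2.2.1 t.1.2.2.2 y.2) t.2.2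

/-- The product of `f` over the eight points of a cube. -/
noncomputable def octProd (f : G → ℝ) (t : (G × G × G × G) × G × G) : ℝ :=
  boxProd f t.1.1 t.1.2.1 t.1.2.2.1 t.1.2.2.2 t.2.1 *
    boxProd f t.1.1 t.1.2.1 t.1.2.2.1 t.1.2.2.2 t.2.2

lemma sum_octProd (f : G → ℝ) : ∑ t, octProd f t = boxEnergy f f f f := by
  simp only [boxEnergy, sq, Finset.sum_mul_sum]
  simp only [Fintype.sum_prod_type]
  rfl

lemma sum_extensionCount (S : Set G) : ∑ t, extensionCount κ S t =
    gridEnergy fun (_ _ : Option (Option κ)) => ind1 S := by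
  simp only [gridEnergy_ind1_eq, sum_option_arrow, extensionCount, sq, Finset.sum_mul_sum]
  simp only [← Fintype.sum_prod_type']
  refine Fintype.sum_equiv ⟨fun x => (x.1.1.1, x.1.1.2.1, x.2.1, x.1.1.2.2.1, x.1.1.2.2.2, x.2.2,
    x.1.2.1, x.1.2.2), fun x => (((x.1, x.2.1, x.2.2.2.1, x.2.2.2.2.1), x.2.2.2.2.2.2),
    x.2.2.1, x.2.2.2.2.2.1), fun _ => rfl, fun _ => rfl⟩ _ _ (fun x => ?_)
  rfl

/-- Two indices of a doubled grid are related unless they belong to different copies. -/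
def SameCopy : Option (Option (κ ⊕ κ)) → Option (Option (κ ⊕ κ)) → Prop
  | some (some x), some (some y) => x.isLeft = y.isLeft
  | _, _ => True

omit [Fintype G] in
lemma gridInd_mul_gridInd (S : Set G) (x x' y y' : G) (a a' b b' : κ → G) (c : G) :
    gridInd S (consTwo x x' a) (consTwo y y' b) c *
        gridInd S (consTwo x x' a') (consTwo y y' b') c =
      ∏ i, ∏ j, if SameCopy i j then
        ind1 S (consTwo x x' (Sum.elim a a') i + consTwo y y' (Sum.elim b b') j + c) else 1 := by
  have h (a b : Option (Option κ) → G) : gridInd S a b c =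
      if ∀ i j, a i + b j + c ∈ S then 1 else 0 := by
    simpa [gridInd] using prod_ite_ind1 S (fun _ _ => True) a b c
  rw [prod_ite_ind1, h, h, mul_ite, mul_one, mul_zero, ← ite_and]
  refine if_congr ?_ rfl rfl
  simp only [Option.forall, Sum.forall, consTwo, SameCopy, Option.elim_none, Option.elim_some,
    Sum.elim_inl, Sum.elim_inr, Sum.isLeft_inl, Sum.isLeft_inr, forall_true_left]
  grind

lemma sum_extensionCount_sq (S : Set G) : ∑ t, extensionCount κ S t ^ 2 =
    configCount S (SameCopy (κ := κ)) := by
  have h : configCount S (SameCopy (κ := κ)) =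
      ∑ x, ∑ x', ∑ a : κ → G, ∑ a' : κ → G, ∑ y, ∑ y', ∑ b : κ → G, ∑ b' : κ → G, (∑ c,
        gridInd S (consTwo x x' a) (consTwo y y' b) c *
          gridInd S (consTwo x x' a') (consTwo y y' b') c) ^ 2 := by
    simp only [configCount, sum_option_arrow, sum_sum_arrow, gridInd_mul_gridInd]
    rfl
  rw [h]
  simp only [extensionCount, sq, Finset.sum_mul_sum]
  simp only [← Fintype.sum_prod_type']
  refine Fintype.sum_equiv ⟨fun x => (x.1.1.1, x.1.1.2.1, x.2.1.1, x.2.2.1, x.1.1.2.2.1,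
    x.1.1.2.2.2, x.2.1.2, x.2.2.2, x.1.2.1, x.1.2.2),
    fun x => (((x.1, x.2.1, x.2.2.2.2.1, x.2.2.2.2.2.1), x.2.2.2.2.2.2.2.2),
    (x.2.2.1, x.2.2.2.2.2.2.1), (x.2.2.2.1, x.2.2.2.2.2.2.2.1)),
    fun _ => rfl, fun _ => rfl⟩ _ _ (fun x => ?_)
  simp only [Equiv.coe_fn_mk]
  ring

end OptionGrid

section GridBound

variable {G : Type*} [AddCommGroup G] [Fintype G]

omit [AddCommGroup G] [Fintype G] in
lemma ind1_mul_self (S : Set G) (x : G) : ind1 S x * ind1 S x = ind1 S x := by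
  rw [ind1_eq_ite]
  split_ifs <;> norm_num

omit [AddCommGroup G] [Fintype G] in
lemma ind1_le_one (S : Set G) (x : G) : ind1 S x ≤ 1 := by
  rw [ind1_eq_ite]
  split_ifs <;> norm_num

omit [AddCommGroup G] [Fintype G] in
lemma mul_ind1_of_abs_le {S : Set G} {F : G → ℝ} (hF : ∀ x, |F x| ≤ ind1 S x) (x : G) :
    F x * ind1 S x = F x := by
  have := hF x
  rw [ind1_eq_ite] at this ⊢
  split_ifs at this ⊢
  · rw [mul_one]
  · rw [abs_nonpos_iff.1 this, zero_mul]

omit [Fintype G] in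
lemma boxProd_mul (f g : G → ℝ) (a a' b b' c : G) :
    boxProd f a a' b b' c * boxProd g a a' b b' c = boxProd (fun x => f x * g x) a a' b b' c := by
  simp only [boxProd]
  ring

omit [Fintype G] in
lemma octProd_mul (f g : G → ℝ) (t : (G × G × G × G) × G × G) :
    octProd f t * octProd g t = octProd (fun x => f x * g x) t := by
  simp only [octProd, ← boxProd_mul]
  ring

lemma gridEnergy_pow_four_le {k : ℕ} (S : Set G) (g : Fin (k + 1) → Fin (k + 1) → G → ℝ)
    (hg : ∀ i j x, |g i j x| ≤ ind1 S x) (i₀ j₀ : Fin (k + 1)) :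
    gridEnergy g ^ 4 ≤ (gridEnergy fun (_ : Option (Fin k)) (_ : Fin k) => ind1 S) ^ 2 *
      (gridEnergy fun (_ : Fin k) (_ : Option (Option (Fin k))) => ind1 S) *
        ∑ t, octProd (g i₀ j₀) t * extensionCount (Fin k) S t := by
  have h1 : gridEnergy g = ∑ y : (Fin k → G) × (Fin k → G), ∑ a, ∑ b,
      (∑ c, g i₀ j₀ (a + b + c) * ((∏ j, g i₀ (j₀.succAbove j) (a + y.2 j + c)) *
        (∏ i, g (i₀.succAbove i) j₀ (y.1 i + b + c)) *
        ∏ i, ∏ j, g (i₀.succAbove i) (j₀.succAbove j) (y.1 i + y.2 j + c))) ^ 2 := by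
    have h0 : ∀ a b, gridSum g a b = ∑ c, g i₀ j₀ (a i₀ + b j₀ + c) *
        ((∏ j, g i₀ (j₀.succAbove j) (a i₀ + b (j₀.succAbove j) + c)) *
          (∏ i, g (i₀.succAbove i) j₀ (a (i₀.succAbove i) + b j₀ + c)) *
          ∏ i, ∏ j, g (i₀.succAbove i) (j₀.succAbove j)
            (a (i₀.succAbove i) + b (j₀.succAbove j) + c)) := by
      intro a b
      refine Finset.sum_congr rfl fun c _ => ?_
      rw [Fin.prod_univ_succAbove _ i₀, Fin.prod_univ_succAbove _ j₀,
        Finset.prod_congr rfl fun i _ => Fin.prod_univ_succAbove _ j₀, Finset.prod_mul_distrib]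
      ring
    simp only [gridEnergy, h0]
    rw [sum_insertNth i₀, Finset.sum_congr rfl fun x _ => Finset.sum_congr rfl fun a _ =>
      sum_insertNth j₀ _]
    simp only [Fin.insertNth_apply_same, Fin.insertNth_apply_succAbove]
    simp only [← Fintype.sum_prod_type']
    refine Fintype.sum_equiv ⟨fun x => ((x.2.1, x.2.2.2), x.1, x.2.2.1),
      fun x => (x.2.1, x.1.1, x.2.2, x.1.2), fun _ => rfl, fun _ => rfl⟩ _ _ (fun x => ?_)
    rfl
  have habs : ∀ (ι : Type) [Fintype ι] (φ : ι → G → ℝ) (x : ι → G),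
      (∀ i x, |φ i x| ≤ ind1 S x) → |∏ i, φ i (x i)| ≤ ∏ i, ind1 S (x i) := by
    intro ι _ φ x hφ
    rw [Finset.abs_prod]
    exact Finset.prod_le_prod (fun _ _ => abs_nonneg _) fun i _ => hφ i _
  have h2 := weighted_box_pow_four_le (Y := (Fin k → G) × (Fin k → G))
    (fun a b c => g i₀ j₀ (a + b + c))
    (fun y a c => ∏ j, g i₀ (j₀.succAbove j) (a + y.2 j + c))
    (fun y a c => ∏ j, ind1 S (a + y.2 j + c))
    (fun y b c => ∏ i, g (i₀.succAbove i) j₀ (y.1 i + b + c))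
    (fun y b c => ∏ i, ind1 S (y.1 i + b + c))
    (fun y c => ∏ i, ∏ j, g (i₀.succAbove i) (j₀.succAbove j) (y.1 i + y.2 j + c))
    (fun y c => gridInd S y.1 y.2 c)
    (fun y a c => habs _ _ _ fun j => hg _ _) (fun y b c => habs _ _ _ fun j => hg _ _)
    (fun y c => by
      simp only [gridInd, ← Fintype.prod_prod_type']
      exact habs _ (fun x : Fin k × Fin k => g (i₀.succAbove x.1) (j₀.succAbove x.2))
        (fun x => y.1 x.1 + y.2 x.2 + c) fun _ => hg _ _)
  rw [sum_gridInd_option_sq, sum_gridInd_option_option_sq, ← h1] at h2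
  refine h2.trans_eq ?_
  congr 1
  have h3 : ∀ (y : (Fin k → G) × (Fin k → G)) (a a' b b' c : G),
      g i₀ j₀ (a + b + c) * g i₀ j₀ (a + b' + c) *
          (g i₀ j₀ (a' + b + c) * g i₀ j₀ (a' + b' + c)) *
        ((∏ j, ind1 S (a + y.2 j + c)) * (∏ j, ind1 S (a' + y.2 j + c)) *
          ((∏ i, ind1 S (y.1 i + b + c)) * ∏ i, ind1 S (y.1 i + b' + c)) *
            gridInd S y.1 y.2 c) =
      boxProd (g i₀ j₀) a a' b b' c * gridInd S (consTwo a a' y.1) (consTwo b b' y.2) c := by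
    intro y a a' b b' c
    rw [gridInd_consTwo, ← mul_assoc (boxProd (g i₀ j₀) a a' b b' c), boxProd_mul]
    simp only [mul_ind1_of_abs_le (hg i₀ j₀)]
    rfl
  simp only [h3, octProd, extensionCount, sq, Finset.sum_mul_sum]
  simp only [Finset.mul_sum]
  simp only [← Fintype.sum_prod_type']
  refine Fintype.sum_equiv ⟨fun x => (((x.2.1, x.2.2.1, x.2.2.2.1, x.2.2.2.2.1),
    x.2.2.2.2.2.1, x.2.2.2.2.2.2), x.1), fun x => (x.2, x.1.1.1, x.1.1.2.1, x.1.1.2.2.1,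
    x.1.1.2.2.2, x.1.2.1, x.1.2.2), fun _ => rfl, fun _ => rfl⟩ _ _ (fun x => ?_)
  simp only [Equiv.coe_fn_mk]
  ring

lemma sum_octProd_mul_extensionCount_le {κ : Type*} [Fintype κ] [DecidableEq κ] (S : Set G)
    (F : G → ℝ) (hF : ∀ x, |F x| ≤ ind1 S x) (w η : ℝ) (hη : 0 ≤ η)
    (h : configCount S (SameCopy (κ := κ)) -
      2 * w * (gridEnergy fun (_ _ : Option (Option κ)) => ind1 S) +
        w ^ 2 * boxEnergy (ind1 S) (ind1 S) (ind1 S) (ind1 S) ≤ η ^ 2) :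
    ∑ t, octProd F t * extensionCount κ S t ≤
      w * boxEnergy F F F F + (Fintype.card G : ℝ) ^ 3 * η := by
  have h1 : ∀ t, octProd (ind1 S) t * extensionCount κ S t = extensionCount κ S t := by
    intro t
    simp only [extensionCount, Finset.mul_sum]
    refine Finset.sum_congr rfl fun y _ => ?_
    have h2 : ∀ c, boxProd (ind1 S) t.1.1 t.1.2.1 t.1.2.2.1 t.1.2.2.2 c *
        gridInd S (consTwo t.1.1 t.1.2.1 y.1) (consTwo t.1.2.2.1 t.1.2.2.2 y.2) c =
        gridInd S (consTwo t.1.1 t.1.2.1 y.1) (consTwo t.1.2.2.1 t.1.2.2.2 y.2) c := by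
      intro c
      rw [gridInd_consTwo, ← mul_assoc, boxProd_mul]
      simp only [ind1_mul_self]
    rw [octProd, mul_mul_mul_comm, h2, h2]
  have h2 : ∀ t, octProd F t * octProd (ind1 S) t = octProd F t := by
    intro t
    rw [octProd_mul]
    simp only [mul_ind1_of_abs_le hF]
  have h3 : ∀ t, octProd (ind1 S) t * octProd (ind1 S) t = octProd (ind1 S) t := by
    intro t
    rw [octProd_mul]
    simp only [ind1_mul_self]
  have h4 : ∀ t, |octProd F t| ≤ 1 := by
    have h5 : ∀ x, |F x| ≤ 1 := fun x => (hF x).trans (ind1_le_one S x)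
    have h6 : ∀ x y, |x| ≤ 1 → |y| ≤ 1 → |x * y| ≤ (1 : ℝ) := fun x y hx hy => by
      rw [abs_mul]
      exact mul_le_one₀ hx (abs_nonneg _) hy
    intro t
    simp only [octProd, boxProd]
    refine h6 _ _ (h6 _ _ (h6 _ _ ?_ ?_) (h6 _ _ ?_ ?_)) (h6 _ _ (h6 _ _ ?_ ?_) (h6 _ _ ?_ ?_)) <;>
      exact h5 _
  set D : (G × G × G × G) × G × G → ℝ := fun t => extensionCount κ S t - w * octProd (ind1 S) t
    with hD
  have h5 : ∑ t, D t ^ 2 ≤ η ^ 2 := by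
    refine le_trans (le_of_eq ?_) h
    rw [← sum_extensionCount_sq, ← sum_extensionCount, ← sum_octProd, Finset.mul_sum,
      Finset.mul_sum, ← Finset.sum_sub_distrib, ← Finset.sum_add_distrib]
    refine Finset.sum_congr rfl fun t _ => ?_
    simp only [hD]
    linear_combination w ^ 2 * h3 t - 2 * w * h1 t
  have h6 : ∑ t, octProd F t * extensionCount κ S t =
      w * boxEnergy F F F F + ∑ t, octProd F t * D t := by
    rw [← sum_octProd, Finset.mul_sum, ← Finset.sum_add_distrib]
    refine Finset.sum_congr rfl fun t _ => ?_
    simp only [hD]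
    linear_combination w * h2 t
  have h7 : (∑ t, octProd F t * D t) ^ 2 ≤ ((Fintype.card G : ℝ) ^ 3 * η) ^ 2 := by
    refine (Finset.sum_mul_sq_le_sq_mul_sq _ _ _).trans ?_
    have h8 : ∑ t, octProd F t ^ 2 ≤ (Fintype.card G : ℝ) ^ 6 := by
      refine (Finset.sum_le_card_nsmul univ _ 1 fun t _ => ?_).trans (le_of_eq ?_)
      · exact (sq_le_one_iff_abs_le_one _).2 (h4 t)
      · simp only [Finset.card_univ, Fintype.card_prod, nsmul_eq_mul, mul_one]
        push_cast
        ring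
    calc _ ≤ (Fintype.card G : ℝ) ^ 6 * η ^ 2 := mul_le_mul h8 h5
          (Finset.sum_nonneg fun _ _ => sq_nonneg _) (by positivity)
      _ = _ := by ring
  rw [h6]
  linarith [le_of_abs_le (abs_le_of_sq_le_sq h7 (by positivity))]

end GridBound

section Counting

variable {p n ℓ q : ℕ}

lemma card_sameCopy (k : ℕ) : (univ.filter fun x : Option (Option (Fin k ⊕ Fin k)) ×
    Option (Option (Fin k ⊕ Fin k)) => SameCopy x.1 x.2).card = 2 * k ^ 2 + 8 * k + 4 := by
  rw [Finset.card_filter, Fintype.sum_prod_type]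
  simp only [Fintype.sum_option, Fintype.sum_sum_type, SameCopy]
  simp
  ring

namespace QuadFactor

lemma abs_configCount_sub_le_of_card [Fact p.Prime] (hodd : Odd p) (B : QuadFactor p n ℓ q)
    (b : Label p ℓ q) {𝔸 𝔹 : Type*} [Fintype 𝔸] [Fintype 𝔹] [DecidableEq 𝔸] [DecidableEq 𝔹]
    (R : 𝔸 → 𝔹 → Prop) (i₀ : 𝔸) (j₀ : 𝔹) (hi : ∀ j, R i₀ j) (hj : ∀ i, R i j₀) (N s : ℕ)
    (hN : Fintype.card 𝔸 + Fintype.card 𝔹 = N)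
    (hs : N + (univ.filter fun x : 𝔸 × 𝔹 => R x.1 x.2).card = s + 1) (e : ℝ) (he₀ : 0 ≤ e)
    (he₁ : e ≤ 1) (he : 1 ≤ e ^ 4 * (p : ℝ) ^ B.rank) :
    |configCount (B.atom b) R -
        ((p : ℝ) ^ n) ^ (N + 2) * (((p : ℝ) ^ ℓ)⁻¹ ^ N * ((p : ℝ) ^ q)⁻¹ ^ s)| ≤
      ((p : ℝ) ^ n) ^ (N + 2) * e := by
  have h1 : (univ.filter fun x : 𝔸 × 𝔹 => R x.1 x.2).card ≠ 0 :=
    Finset.card_ne_zero.2 ⟨(i₀, j₀), by simpa using hi j₀⟩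
  obtain ⟨r, hr⟩ := Nat.exists_eq_succ_of_ne_zero h1
  have h2 := abs_configCount_sub_le hodd B b R i₀ j₀ hi hj N r hN hr e he₀ he₁ he
  have h3 : s = N + r := by omega
  have h4 : ((p : ℝ) ^ ℓ)⁻¹ ^ N * ((p : ℝ) ^ q)⁻¹ ^ s =
      ((p : ℝ) ^ (N * ℓ + (N * q + r * q)))⁻¹ := by
    rw [h3]
    simp only [inv_pow, ← mul_inv, ← pow_mul, ← pow_add]
    congr 2
    ring
  rw [h4, ← div_eq_mul_inv]
  exact h2

/-- Two-sided bounds for the number of full grids in an atom of large rank. -/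
lemma gridEnergy_ind1_bounds [Fact p.Prime] (hodd : Odd p) (B : QuadFactor p n ℓ q)
    (b : Label p ℓ q) {𝔸 𝔹 : Type*} [Fintype 𝔸] [Fintype 𝔹] [DecidableEq 𝔸] [DecidableEq 𝔹]
    [Nonempty 𝔸] [Nonempty 𝔹] (N s N' s' : ℕ) (hN : Fintype.card 𝔸 + Fintype.card 𝔹 = N)
    (hs : N + Fintype.card 𝔸 * Fintype.card 𝔹 = s + 1) (hN' : N ≤ N') (hs' : s ≤ s') (e : ℝ)
    (he₀ : 0 ≤ e) (he₁ : 2 * e ≤ ((p : ℝ) ^ ℓ)⁻¹ ^ N' * ((p : ℝ) ^ q)⁻¹ ^ s')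
    (he : 1 ≤ e ^ 4 * (p : ℝ) ^ B.rank) :
    ((p : ℝ) ^ n) ^ (N + 2) * (((p : ℝ) ^ ℓ)⁻¹ ^ N * ((p : ℝ) ^ q)⁻¹ ^ s) ≤
        2 * (gridEnergy fun (_ : 𝔸) (_ : 𝔹) => ind1 (B.atom b)) ∧
      (gridEnergy fun (_ : 𝔸) (_ : 𝔹) => ind1 (B.atom b)) ≤
        2 * (((p : ℝ) ^ n) ^ (N + 2) * (((p : ℝ) ^ ℓ)⁻¹ ^ N * ((p : ℝ) ^ q)⁻¹ ^ s)) := by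
  have hp : (1 : ℝ) ≤ p := by exact_mod_cast (Fact.out : p.Prime).one_le
  have hinv : ∀ m, 0 ≤ ((p : ℝ) ^ m)⁻¹ ∧ ((p : ℝ) ^ m)⁻¹ ≤ 1 := fun m =>
    ⟨by positivity, inv_le_one_of_one_le₀ (one_le_pow₀ hp)⟩
  have h1 : ((p : ℝ) ^ ℓ)⁻¹ ^ N' * ((p : ℝ) ^ q)⁻¹ ^ s' ≤
      ((p : ℝ) ^ ℓ)⁻¹ ^ N * ((p : ℝ) ^ q)⁻¹ ^ s :=
    mul_le_mul (pow_le_pow_of_le_one (hinv ℓ).1 (hinv ℓ).2 hN')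
      (pow_le_pow_of_le_one (hinv q).1 (hinv q).2 hs') (pow_nonneg (hinv q).1 _)
      (pow_nonneg (hinv ℓ).1 _)
  have h2 : ((p : ℝ) ^ ℓ)⁻¹ ^ N * ((p : ℝ) ^ q)⁻¹ ^ s ≤ 1 :=
    mul_le_one₀ (pow_le_one₀ (hinv ℓ).1 (hinv ℓ).2) (pow_nonneg (hinv q).1 _)
      (pow_le_one₀ (hinv q).1 (hinv q).2)
  have h3 := abs_le.1 (abs_configCount_sub_le_of_card hodd B b (fun (_ : 𝔸) (_ : 𝔹) => True)
    (Classical.arbitrary 𝔸) (Classical.arbitrary 𝔹) (fun _ => trivial) (fun _ => trivial) N s hN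
    (by simpa using hs) e he₀ (by linarith) he)
  rw [← gridEnergy_ind1_eq_configCount] at h3
  have h4 : ((p : ℝ) ^ n) ^ (N + 2) * (2 * e) ≤
      ((p : ℝ) ^ n) ^ (N + 2) * (((p : ℝ) ^ ℓ)⁻¹ ^ N * ((p : ℝ) ^ q)⁻¹ ^ s) :=
    mul_le_mul_of_nonneg_left (he₁.trans h1) (by positivity)
  have h5 : 0 ≤ ((p : ℝ) ^ n) ^ (N + 2) * (((p : ℝ) ^ ℓ)⁻¹ ^ N * ((p : ℝ) ^ q)⁻¹ ^ s) := by
    positivity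
  constructor <;> linarith [h3.1, h3.2]

/-- The second moment bound for the number of extensions of cubes to grids. -/
lemma extensionCount_variance_le [Fact p.Prime] (hodd : Odd p) (B : QuadFactor p n ℓ q)
    (b : Label p ℓ q) (k : ℕ) (e : ℝ) (he₀ : 0 ≤ e) (he₁ : e ≤ 1)
    (he : 1 ≤ (e ^ 2) ^ 4 * (p : ℝ) ^ B.rank) (w : ℝ)
    (hw : w = ((p : ℝ) ^ n) ^ (2 * k) *
      (((p : ℝ) ^ ℓ)⁻¹ ^ (2 * k) * ((p : ℝ) ^ q)⁻¹ ^ (k ^ 2 + 6 * k))) :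
    configCount (B.atom b) (SameCopy (κ := Fin k)) -
      2 * w * (gridEnergy fun (_ _ : Option (Option (Fin k))) => ind1 (B.atom b)) +
        w ^ 2 * boxEnergy (ind1 (B.atom b)) (ind1 (B.atom b)) (ind1 (B.atom b))
          (ind1 (B.atom b)) ≤ (2 * ((p : ℝ) ^ n) ^ (2 * k + 3) * e) ^ 2 := by
  have hp : (1 : ℝ) ≤ p := by exact_mod_cast (Fact.out : p.Prime).one_le
  have hinv : ∀ m, 0 ≤ ((p : ℝ) ^ m)⁻¹ ∧ ((p : ℝ) ^ m)⁻¹ ≤ 1 := fun m =>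
    ⟨by positivity, inv_le_one_of_one_le₀ (one_le_pow₀ hp)⟩
  have he₂ : e ^ 2 ≤ 1 := pow_le_one₀ he₀ he₁
  have h1 := abs_le.1 (abs_configCount_sub_le_of_card hodd B b (SameCopy (κ := Fin k)) none none
    (fun _ => by simp [SameCopy]) (fun i => by cases i <;> simp [SameCopy]) (4 * k + 4)
    (2 * k ^ 2 + 12 * k + 7) (by simp; ring) (by rw [card_sameCopy]; ring) (e ^ 2) (sq_nonneg e)
    he₂ he)
  have h2 := abs_le.1 (abs_configCount_sub_le_of_card hodd B b
    (fun (_ _ : Option (Option (Fin k))) => True) none none (fun _ => trivial) (fun _ => trivial)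
    (2 * k + 4) (k ^ 2 + 6 * k + 7) (by simp; ring) (by simp; ring) (e ^ 2) (sq_nonneg e) he₂ he)
  have h3 := abs_le.1 (abs_configCount_sub_le_of_card hodd B b (fun (_ _ : Fin 2) => True) 0 0
    (fun _ => trivial) (fun _ => trivial) 4 7 (by simp) (by simp) (e ^ 2) (sq_nonneg e) he₂ he)
  rw [← gridEnergy_ind1_eq_configCount] at h2 h3
  rw [gridEnergy_fin_two] at h3
  set Λ := ((p : ℝ) ^ ℓ)⁻¹ with hΛ
  set Θ := ((p : ℝ) ^ q)⁻¹ with hΘ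
  set g := (p : ℝ) ^ n with hg
  have hw₀ : 0 ≤ w := by rw [hw]; positivity
  have hw₁ : w ≤ g ^ (2 * k) := by
    rw [hw]
    refine mul_le_of_le_one_right (by positivity) ?_
    exact mul_le_one₀ (pow_le_one₀ (hinv ℓ).1 (hinv ℓ).2) (pow_nonneg (hinv q).1 _)
      (pow_le_one₀ (hinv q).1 (hinv q).2)
  have h4 := mul_le_mul_of_nonneg_left h2.1 (mul_nonneg zero_le_two hw₀)
  have h5 := mul_le_mul_of_nonneg_left h3.2 (sq_nonneg w)
  have h6 : 2 * w * (g ^ (2 * k + 4 + 2) * e ^ 2) ≤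
      2 * g ^ (2 * k) * (g ^ (2 * k + 4 + 2) * e ^ 2) := by gcongr
  have h7 : w ^ 2 * (g ^ (4 + 2) * e ^ 2) ≤ (g ^ (2 * k)) ^ 2 * (g ^ (4 + 2) * e ^ 2) := by gcongr
  have h8 : g ^ (4 * k + 4 + 2) * (Λ ^ (4 * k + 4) * Θ ^ (2 * k ^ 2 + 12 * k + 7)) -
      2 * w * (g ^ (2 * k + 4 + 2) * (Λ ^ (2 * k + 4) * Θ ^ (k ^ 2 + 6 * k + 7))) +
        w ^ 2 * (g ^ (4 + 2) * (Λ ^ 4 * Θ ^ 7)) = 0 := by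
    rw [hw]
    ring
  have h9 : (2 * g ^ (2 * k + 3) * e) ^ 2 = g ^ (4 * k + 4 + 2) * e ^ 2 +
      2 * g ^ (2 * k) * (g ^ (2 * k + 4 + 2) * e ^ 2) +
        (g ^ (2 * k)) ^ 2 * (g ^ (4 + 2) * e ^ 2) := by
    ring
  rw [h9]
  linarith [h1.2]

lemma gridEnergy_pow_four_le_of_boxEnergy_le [Fact p.Prime] (hodd : Odd p)
    (B : QuadFactor p n ℓ q) (b : Label p ℓ q) (k : ℕ) (hk : 1 ≤ k) (e δ : ℝ) (he₀ : 0 ≤ e)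
    (he : 1 ≤ (e ^ 2) ^ 4 * (p : ℝ) ^ B.rank) (hδ₀ : 0 ≤ δ) (hδ₁ : δ ≤ 1)
    (heδ : 2 * e ≤
      δ * (((p : ℝ) ^ ℓ)⁻¹ ^ (2 * k + 4) * ((p : ℝ) ^ q)⁻¹ ^ (k ^ 2 + 6 * k + 7)))
    (g : Fin (k + 1) → Fin (k + 1) → Vec p n → ℝ) (hg : ∀ i j x, |g i j x| ≤ ind1 (B.atom b) x)
    (i₀ j₀ : Fin (k + 1))
    (hF : boxEnergy (g i₀ j₀) (g i₀ j₀) (g i₀ j₀) (g i₀ j₀) ≤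
      δ * boxEnergy (ind1 (B.atom b)) (ind1 (B.atom b)) (ind1 (B.atom b)) (ind1 (B.atom b))) :
    gridEnergy g ^ 4 ≤ 384 * δ *
      (gridEnergy fun (_ _ : Fin (k + 1)) => ind1 (B.atom b)) ^ 4 := by
  have hp : (1 : ℝ) ≤ p := by exact_mod_cast (Fact.out : p.Prime).one_le
  have : Nonempty (Fin k) := ⟨⟨0, hk⟩⟩
  have hinv : ∀ m, 0 ≤ ((p : ℝ) ^ m)⁻¹ ∧ ((p : ℝ) ^ m)⁻¹ ≤ 1 := fun m =>
    ⟨by positivity, inv_le_one_of_one_le₀ (one_le_pow₀ hp)⟩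
  have h0 : ((p : ℝ) ^ ℓ)⁻¹ ^ (2 * k + 4) * ((p : ℝ) ^ q)⁻¹ ^ (k ^ 2 + 6 * k + 7) ≤ 1 :=
    mul_le_one₀ (pow_le_one₀ (hinv ℓ).1 (hinv ℓ).2) (pow_nonneg (hinv q).1 _)
      (pow_le_one₀ (hinv q).1 (hinv q).2)
  have h0' : 2 * e ≤ ((p : ℝ) ^ ℓ)⁻¹ ^ (2 * k + 4) * ((p : ℝ) ^ q)⁻¹ ^ (k ^ 2 + 6 * k + 7) :=
    heδ.trans (mul_le_of_le_one_left (mul_nonneg (pow_nonneg (hinv ℓ).1 _)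
      (pow_nonneg (hinv q).1 _)) hδ₁)
  have he₁ : e ≤ 1 := by linarith
  have he₂ : 2 * e ^ 2 ≤
      ((p : ℝ) ^ ℓ)⁻¹ ^ (2 * k + 4) * ((p : ℝ) ^ q)⁻¹ ^ (k ^ 2 + 6 * k + 7) :=
    le_trans (by nlinarith) h0'
  obtain ⟨-, hX₁⟩ := gridEnergy_ind1_bounds hodd B b (𝔸 := Option (Fin k)) (𝔹 := Fin k) (2 * k + 1)
    (k ^ 2 + 3 * k) _ _ (by simp; ring) (by simp; ring) (by linarith) (by linarith) _ (sq_nonneg e)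
    he₂ he
  obtain ⟨-, hX₂⟩ := gridEnergy_ind1_bounds hodd B b (𝔸 := Fin k) (𝔹 := Option (Option (Fin k)))
    (2 * k + 2) (k ^ 2 + 4 * k + 1) _ _ (by simp; ring) (by simp; ring) (by linarith) (by linarith)
    _ (sq_nonneg e) he₂ he
  obtain ⟨-, hC⟩ := gridEnergy_ind1_bounds hodd B b (𝔸 := Fin 2) (𝔹 := Fin 2) 4 7 _ _ (by simp)
    (by simp) (by linarith) (by linarith [Nat.zero_le (k ^ 2)]) _ (sq_nonneg e) he₂ he
  obtain ⟨hM, -⟩ := gridEnergy_ind1_bounds hodd B b (𝔸 := Fin (k + 1)) (𝔹 := Fin (k + 1))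
    (2 * k + 2) (k ^ 2 + 4 * k + 2) _ _ (by simp; ring) (by simp; ring) (by linarith) (by linarith)
    _ (sq_nonneg e) he₂ he
  have hV := extensionCount_variance_le hodd B b k e he₀ he₁ he _ rfl
  have hE := gridEnergy_pow_four_le (B.atom b) g hg i₀ j₀
  have hS := sum_octProd_mul_extensionCount_le (B.atom b) (g i₀ j₀) (hg i₀ j₀) _ _
    (by positivity) hV
  rw [gridEnergy_fin_two] at hC
  have hcard : (Fintype.card (Vec p n) : ℝ) = (p : ℝ) ^ n := by
    simp [ZMod.card]
  rw [hcard] at hS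
  set Λ := ((p : ℝ) ^ ℓ)⁻¹ with hΛ
  set Θ := ((p : ℝ) ^ q)⁻¹ with hΘ
  set γ := (p : ℝ) ^ n with hγ
  set X₁ := gridEnergy fun (_ : Option (Fin k)) (_ : Fin k) => ind1 (B.atom b)
  set X₂ := gridEnergy fun (_ : Fin k) (_ : Option (Option (Fin k))) => ind1 (B.atom b)
  set M := gridEnergy fun (_ _ : Fin (k + 1)) => ind1 (B.atom b)
  have hX₁0 : 0 ≤ X₁ := Finset.sum_nonneg fun _ _ => Finset.sum_nonneg fun _ _ => sq_nonneg _
  have hX₂0 : 0 ≤ X₂ := Finset.sum_nonneg fun _ _ => Finset.sum_nonneg fun _ _ => sq_nonneg _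
  set w := γ ^ (2 * k) * (Λ ^ (2 * k) * Θ ^ (k ^ 2 + 6 * k)) with hw
  have hw₀ : 0 ≤ w := by positivity
  set D := γ ^ (4 + 2) * (Λ ^ 4 * Θ ^ 7) with hD
  have h1 : γ ^ 3 * (2 * γ ^ (2 * k + 3) * e) ≤ w * (δ * D) := by
    calc γ ^ 3 * (2 * γ ^ (2 * k + 3) * e) = γ ^ (2 * k + 6) * (2 * e) := by ring
      _ ≤ γ ^ (2 * k + 6) * (δ * (Λ ^ (2 * k + 4) * Θ ^ (k ^ 2 + 6 * k + 7))) := by gcongr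
      _ = w * (δ * D) := by rw [hw, hD]; ring
  have h2 : ∑ t, octProd (g i₀ j₀) t * extensionCount (Fin k) (B.atom b) t ≤
      w * (3 * δ * D) := by
    calc _ ≤ w * (δ * (2 * D)) + w * (δ * D) := by
          refine hS.trans (add_le_add (mul_le_mul_of_nonneg_left (hF.trans ?_) hw₀) h1)
          gcongr
      _ = _ := by ring
  set m := γ ^ (2 * k + 2 + 2) * (Λ ^ (2 * k + 2) * Θ ^ (k ^ 2 + 4 * k + 2)) with hm
  have hm₀ : 0 ≤ m := by positivity
  calc gridEnergy g ^ 4 ≤ X₁ ^ 2 * X₂ * (w * (3 * δ * D)) :=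
        hE.trans (mul_le_mul_of_nonneg_left h2 (by positivity))
    _ ≤ (2 * (γ ^ (2 * k + 1 + 2) * (Λ ^ (2 * k + 1) * Θ ^ (k ^ 2 + 3 * k)))) ^ 2 *
        (2 * (γ ^ (2 * k + 2 + 2) * (Λ ^ (2 * k + 2) * Θ ^ (k ^ 2 + 4 * k + 1)))) *
          (w * (3 * δ * D)) := by gcongr
    _ = 24 * δ * m ^ 4 := by rw [hw, hD, hm]; ring
    _ ≤ 24 * δ * (2 * M) ^ 4 := by gcongr
    _ = _ := by ring

end QuadFactor

end Counting

section Conclusion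

variable {p n ℓ q : ℕ}

/-- The error term allowed by the rank of the factor. -/
lemma exists_pow_mul_pow_le [Fact p.Prime] (c₀ c₁ : ℕ) (ε : ℝ) (hε₀ : 0 < ε) (hε₁ : ε ≤ 1)
    (ℓ q r : ℕ)
    (h : 8 * ((c₀ : ℝ) + c₁) * ((ℓ : ℝ) + q + Real.logb p ε⁻¹) ≤ r) :
    ∃ e : ℝ, 0 ≤ e ∧ 1 ≤ e ^ 8 * (p : ℝ) ^ r ∧
      e ≤ ε ^ c₁ * (((p : ℝ) ^ ℓ)⁻¹ ^ c₀ * ((p : ℝ) ^ q)⁻¹ ^ c₀) := by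
  have hp₁ : (1 : ℝ) < p := by exact_mod_cast (Fact.out : p.Prime).one_lt
  have hp₀ : (0 : ℝ) < p := by linarith
  set t := Real.logb p ε⁻¹ with ht
  have ht₀ : 0 ≤ t := Real.logb_nonneg hp₁ ((one_le_inv₀ hε₀).2 hε₁)
  have hεt : ε = (p : ℝ) ^ (-t) := by
    rw [Real.rpow_neg hp₀.le, ht, Real.rpow_logb hp₀ hp₁.ne' (inv_pos.2 hε₀), inv_inv]
  have hpow : ∀ m : ℕ, ((p : ℝ) ^ m)⁻¹ = (p : ℝ) ^ (-(m : ℝ)) := fun m => by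
    rw [Real.rpow_neg hp₀.le, Real.rpow_natCast]
  refine ⟨(p : ℝ) ^ (-(r : ℝ) / 8), by positivity, ?_, ?_⟩
  · rw [← Real.rpow_natCast, ← Real.rpow_natCast, ← Real.rpow_mul hp₀.le, ← Real.rpow_add hp₀]
    refine Real.one_le_rpow hp₁.le (le_of_eq ?_)
    push_cast
    ring
  · rw [hεt, hpow, hpow, ← Real.rpow_natCast, ← Real.rpow_natCast, ← Real.rpow_natCast,
      ← Real.rpow_mul hp₀.le, ← Real.rpow_mul hp₀.le, ← Real.rpow_mul hp₀.le,
      ← Real.rpow_add hp₀, ← Real.rpow_add hp₀]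
    refine Real.rpow_le_rpow_of_exponent_le hp₁.le ?_
    have h1 : 0 ≤ (c₀ : ℝ) * t + c₁ * (ℓ + q) := by positivity
    linarith

lemma sum_inv_pow_mul_lt_one {ι : Type*} [Fintype ι] [DecidableEq ι] (ε : ℝ) (hε₀ : 0 < ε)
    (hε₁ : ε ≤ 1) :
    ∑ T ∈ (univ : Finset (Finset ι)).erase ∅,
      ε⁻¹ ^ T.card * ((ε / 2) ^ Fintype.card ι / 2) < 1 := by
  have h1 : ∀ T ∈ (univ : Finset (Finset ι)).erase ∅,
      ε⁻¹ ^ T.card * ((ε / 2) ^ Fintype.card ι / 2) ≤ (1 / 2) ^ Fintype.card ι / 2 := by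
    intro T _
    have h2 : ε⁻¹ ^ T.card ≤ ε⁻¹ ^ Fintype.card ι :=
      pow_le_pow_right₀ ((one_le_inv₀ hε₀).2 hε₁) (Finset.card_le_univ T)
    calc _ ≤ ε⁻¹ ^ Fintype.card ι * ((ε / 2) ^ Fintype.card ι / 2) := by gcongr
      _ = (ε⁻¹ * (ε / 2)) ^ Fintype.card ι / 2 := by rw [mul_pow]; ring
      _ = _ := by congr 2; field_simp
  refine (Finset.sum_le_card_nsmul _ _ _ h1).trans_lt ?_
  have h3 : (((univ : Finset (Finset ι)).erase ∅).card : ℝ) ≤ 2 ^ Fintype.card ι := by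
    have h := Finset.card_le_univ ((univ : Finset (Finset ι)).erase ∅)
    rw [Fintype.card_finset] at h
    exact_mod_cast h
  rw [nsmul_eq_mul]
  calc _ ≤ (2 : ℝ) ^ Fintype.card ι * ((1 / 2) ^ Fintype.card ι / 2) := by gcongr
    _ = (2 * (1 / 2)) ^ Fintype.card ι / 2 := by rw [mul_pow]; ring
    _ < 1 := by norm_num

lemma succ_sq_add_one_le_sq_mul_two_pow {k : ℕ} (hk : 2 ≤ k) :
    (k + 1) ^ 2 + 1 ≤ k ^ 2 * 2 ^ k ^ 2 := by
  have h1 : k ^ 2 + 1 ≤ 2 ^ k ^ 2 := Nat.lt_two_pow_self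
  have h2 : 4 ≤ k ^ 2 := by nlinarith
  calc (k + 1) ^ 2 + 1 ≤ 4 * (k ^ 2 + 1) := by nlinarith
    _ ≤ _ := Nat.mul_le_mul h2 h1

/-- Shattering by sets which are quasirandom of intermediate density on an atom of large rank. -/
lemma QuadFactor.hasVC2Dim_succ [Fact p.Prime] (hodd : Odd p) (B : QuadFactor p n ℓ q)
    (b : Label p ℓ q) (k N : ℕ) (hk : 1 ≤ k) (hN : (k + 1) ^ 2 + 1 ≤ N) (A : Set (Vec p n))
    (ε α : ℝ) (hε₀ : 0 < ε) (hε₁ : ε ≤ 1 / 4) (hα₀ : ε ≤ α) (hα₁ : α ≤ 1 - ε)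
    (hrank : 8 * (((k ^ 2 + 6 * k + 7 : ℕ) : ℝ) + (16 * N + 9 : ℕ)) *
      ((ℓ : ℝ) + q + Real.logb p ε⁻¹) ≤ B.rank)
    (hU : U3pow8 (fun x => (ind1 A x - α) * ind1 (B.atom b) x) ≤
      ((ε / 4) ^ N * 2⁻¹) ^ 8 * U3pow8 (ind1 (B.atom b))) : HasVC2Dim A (k + 1) := by
  have hp : (1 : ℝ) ≤ p := by exact_mod_cast (Fact.out : p.Prime).one_le
  have hp₀ : (0 : ℝ) < p := by linarith
  have hinv : ∀ m, 0 ≤ ((p : ℝ) ^ m)⁻¹ ∧ ((p : ℝ) ^ m)⁻¹ ≤ 1 := fun m =>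
    ⟨by positivity, inv_le_one_of_one_le₀ (one_le_pow₀ hp)⟩
  obtain ⟨e, he₀, he, hee⟩ := exists_pow_mul_pow_le _ _ ε hε₀ (by linarith) ℓ q _ hrank
  have he' : 1 ≤ (e ^ 2) ^ 4 * (p : ℝ) ^ B.rank := by rwa [← pow_mul]
  set δ := ((ε / 4) ^ N * 2⁻¹) ^ 8 with hδ
  have hδ₀ : 0 ≤ δ := by positivity
  have hδ₁ : δ ≤ 1 := by
    refine pow_le_one₀ (by positivity) (mul_le_one₀ ?_ (by norm_num) (by norm_num))
    exact pow_le_one₀ (by positivity) (by linarith)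
  have heδ : 2 * e ≤
      δ * (((p : ℝ) ^ ℓ)⁻¹ ^ (2 * k + 4) * ((p : ℝ) ^ q)⁻¹ ^ (k ^ 2 + 6 * k + 7)) := by
    have h1 : 2 * ε ^ (16 * N + 9) ≤ δ := by
      have h2 : ε ^ (16 * N) ≤ (ε / 4) ^ (8 * N) := by
        rw [show 16 * N = 2 * (8 * N) by ring, pow_mul]
        exact pow_le_pow_left₀ (by positivity) (by nlinarith) _
      have h3 : ε ^ 9 ≤ (1 / 4) ^ 9 := pow_le_pow_left₀ hε₀.le hε₁ _
      calc 2 * ε ^ (16 * N + 9) = 2 * (ε ^ (16 * N) * ε ^ 9) := by rw [pow_add]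
        _ ≤ 2 * ((ε / 4) ^ (8 * N) * (1 / 4) ^ 9) := by gcongr
        _ ≤ (ε / 4) ^ (8 * N) * 2⁻¹ ^ 8 := by
          have : 0 ≤ (ε / 4) ^ (8 * N) := by positivity
          norm_num
          linarith
        _ = δ := by rw [hδ, mul_pow, ← pow_mul, mul_comm 8 N]
    have h4 : ((p : ℝ) ^ ℓ)⁻¹ ^ (k ^ 2 + 6 * k + 7) ≤ ((p : ℝ) ^ ℓ)⁻¹ ^ (2 * k + 4) :=
      pow_le_pow_of_le_one (hinv ℓ).1 (hinv ℓ).2 (by linarith [Nat.zero_le (k ^ 2)])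
    calc 2 * e ≤ 2 * (ε ^ (16 * N + 9) * (((p : ℝ) ^ ℓ)⁻¹ ^ (k ^ 2 + 6 * k + 7) *
          ((p : ℝ) ^ q)⁻¹ ^ (k ^ 2 + 6 * k + 7))) := by gcongr
      _ = 2 * ε ^ (16 * N + 9) * (((p : ℝ) ^ ℓ)⁻¹ ^ (k ^ 2 + 6 * k + 7) *
          ((p : ℝ) ^ q)⁻¹ ^ (k ^ 2 + 6 * k + 7)) := by ring
      _ ≤ _ := by gcongr
  set S := B.atom b with hS
  set f : Vec p n → ℝ := fun x => ind1 A x - α with hf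
  have hf₁ : ∀ x, |f x| ≤ 1 := by
    intro x
    rw [hf, abs_le]
    constructor <;> linarith [ind1_nonneg A x, ind1_le_one A x]
  have hF : boxEnergy (fun x => f x * ind1 S x) (fun x => f x * ind1 S x)
      (fun x => f x * ind1 S x) (fun x => f x * ind1 S x) ≤
        δ * boxEnergy (ind1 S) (ind1 S) (ind1 S) (ind1 S) := by
    rw [boxEnergy_self_eq_U3pow8, boxEnergy_self_eq_U3pow8, mul_left_comm]
    gcongr
  set θ := (ε / 2) ^ Fintype.card (Fin (k + 1) × Fin (k + 1)) / 2 with hθ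
  have hδθ : 384 * δ ≤ (θ ^ 2) ^ 4 := by
    have hcard : Fintype.card (Fin (k + 1) × Fin (k + 1)) = (k + 1) ^ 2 := by simp [sq]
    have h1 : (ε / 4) ^ N ≤ (ε / 4) ^ ((k + 1) ^ 2 + 1) :=
      pow_le_pow_of_le_one (by positivity) (by linarith) hN
    have h2 : (ε / 4) ^ (k + 1) ^ 2 ≤ (ε / 2) ^ (k + 1) ^ 2 := by gcongr; norm_num
    have h3 : (ε / 4) ^ N ≤ (ε / 2) ^ (k + 1) ^ 2 * (1 / 16) := by
      rw [pow_succ] at h1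
      refine h1.trans (mul_le_mul h2 (by linarith) (by positivity) (by positivity))
    rw [hθ, hδ, hcard]
    calc 384 * ((ε / 4) ^ N * 2⁻¹) ^ 8 ≤
          384 * ((ε / 2) ^ (k + 1) ^ 2 * (1 / 16) * 2⁻¹) ^ 8 := by gcongr
      _ = 384 * (1 / 16) ^ 8 * (((ε / 2) ^ (k + 1) ^ 2 / 2) ^ 2) ^ 4 := by ring
      _ ≤ 1 * (((ε / 2) ^ (k + 1) ^ 2 / 2) ^ 2) ^ 4 := by gcongr; norm_num
      _ = _ := one_mul _
  have hM : 0 < gridEnergy fun (_ _ : Fin (k + 1)) => ind1 S := by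
    have h0 : 2 * e ^ 2 ≤
        ((p : ℝ) ^ ℓ)⁻¹ ^ (2 * k + 4) * ((p : ℝ) ^ q)⁻¹ ^ (k ^ 2 + 6 * k + 7) := by
      have h1 : ((p : ℝ) ^ ℓ)⁻¹ ^ (2 * k + 4) * ((p : ℝ) ^ q)⁻¹ ^ (k ^ 2 + 6 * k + 7) ≤ 1 :=
        mul_le_one₀ (pow_le_one₀ (hinv ℓ).1 (hinv ℓ).2) (pow_nonneg (hinv q).1 _)
          (pow_le_one₀ (hinv q).1 (hinv q).2)
      have h2 := heδ.trans (mul_le_of_le_one_left (mul_nonneg (pow_nonneg (hinv ℓ).1 _)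
        (pow_nonneg (hinv q).1 _)) hδ₁)
      nlinarith
    obtain ⟨h1, -⟩ := gridEnergy_ind1_bounds hodd B b (𝔸 := Fin (k + 1)) (𝔹 := Fin (k + 1))
      (2 * k + 2) (k ^ 2 + 4 * k + 2) _ _ (by simp; ring) (by simp; ring) (by linarith)
      (by linarith) _ (sq_nonneg e) h0 he'
    refine pos_of_mul_pos_right (lt_of_lt_of_le ?_ h1) zero_le_two
    positivity
  refine hasVC2Dim_of_gridEnergy_le (k + 1) S A α ε hε₀ hα₀ hα₁ (fun _ => θ)
    (fun _ => by positivity) hM (fun T hT => ?_) (sum_inv_pow_mul_lt_one ε hε₀ (by linarith))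
  obtain ⟨⟨i₀, j₀⟩, hT⟩ := Finset.nonempty_iff_ne_empty.2 hT
  have hg : ∀ i j x, |localFamily S f T i j x| ≤ ind1 S x := by
    intro i j x
    rw [localFamily]
    split_ifs
    · rw [abs_mul, abs_of_nonneg (ind1_nonneg S x)]
      exact mul_le_of_le_one_left (ind1_nonneg S x) (hf₁ x)
    · rw [abs_of_nonneg (ind1_nonneg S x)]
  have hij : localFamily S f T i₀ j₀ = fun x => f x * ind1 S x := funext fun x => if_pos hT
  have h1 := gridEnergy_pow_four_le_of_boxEnergy_le hodd B b k hk e δ he₀ he' hδ₀ hδ₁ heδ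
    (localFamily S f T) hg i₀ j₀ (by rwa [hij])
  refine le_of_pow_le_pow_left₀ (n := 4) (by norm_num) (by positivity) (h1.trans ?_)
  rw [mul_pow]
  gcongr

end Conclusion

theorem statement3 (p : ℕ) (hp : p.Prime) (hodd : Odd p) [NeZero p]
    (k : ℕ) (hk : 1 ≤ k) :
    ∃ K > (0 : ℝ), ∀ ε : ℝ, 0 < ε → ε < 1 / 11 →
      ∀ (n ℓ q : ℕ) (B : QuadFactor p n ℓ q),
        K * ((ℓ : ℝ) + (q : ℝ) + Real.logb p ε⁻¹) ≤ (B.rank : ℝ) →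
        ∀ A : Set (Vec p n), VC2dimLE A k →
          ∀ b : Label p ℓ q,
            U3localP (fun x => ind1 A x - density A (B.atom b)) (B.atom b) <
              (ε / 4) ^ (k ^ 2 * 2 ^ k ^ 2) * 2⁻¹ →
            density A (B.atom b) ∈ Set.Ico (0 : ℝ) ε ∪ Set.Ioc (1 - ε) 1 := by
  have : Fact p.Prime := ⟨hp⟩
  refine ⟨8 * (((k ^ 2 + 6 * k + 7 : ℕ) : ℝ) + (16 * (k ^ 2 * 2 ^ k ^ 2) + 9 : ℕ)),
    by positivity, ?_⟩
  intro ε hε₀ hε₁ n ℓ q B hrank A hA b hU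
  have hd₀ : 0 ≤ density A (B.atom b) := div_nonneg (Nat.cast_nonneg _) (Nat.cast_nonneg _)
  have hd₁ : density A (B.atom b) ≤ 1 := div_le_one_of_le₀
    (by exact_mod_cast Set.ncard_le_ncard Set.inter_subset_right (Set.toFinite _))
    (Nat.cast_nonneg _)
  by_contra hcon
  simp only [Set.mem_union, Set.mem_Ico, Set.mem_Ioc, hd₀, hd₁, true_and, and_true, not_or,
    not_lt] at hcon
  have hne : (B.atom b).Nonempty := by
    by_contra hempty
    rw [Set.not_nonempty_iff_eq_empty] at hempty
    rw [hempty] at hcon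
    simp only [density, Set.ncard_empty, Nat.cast_zero, div_zero] at hcon
    linarith [hcon.1]
  have hU' := U3pow8_le_of_U3localP_lt _ _ hne _ hU
  have hdim : HasVC2Dim A (k + 1) := by
    rcases hk.eq_or_lt with rfl | hk₂
    · refine hasVC2Dim_two_of_U3pow8_le _ A hne _ ε hε₀ hε₁ hcon.1 hcon.2 (hU'.trans_eq ?_)
      congr 2
      ring
    · exact B.hasVC2Dim_succ hodd b k _ hk (succ_sq_add_one_le_sq_mul_two_pow hk₂) A ε _ hε₀
        (by linarith) hcon.1 hcon.2 hrank hU'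
  exact absurd (hA _ hdim) (by omega)

end PaperTS
end

section
/- Let p be an odd prime, let ℓ,q ≥ 0 be integers, let 𝓑 = (L,Q) be a quadratic factor on G = 𝔽_p^n of complexity (ℓ,q), and let B be an atom of 𝓑. Then for any (x,h_1,h_2,h_3) ∈ G⁴ the following are equivalent: (1) (x,h_1,h_2,h_3) ∈ Ω_B; (2) x ∈ B, h_i ∈ L(0) for all i ∈ {1,2,3} (i.e. h_i·r = 0 for all r ∈ L), 2β_Q(x,h_i) = −β_Q(h_i,h_i) for all i ∈ {1,2,3}, and β_Q(h_i,h_j) = 0 for all i ≠ j ∈ {1,2,3}. -/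
open scoped BigOperators symmDiff
open Finset

attribute [local instance] Classical.propDecidable

namespace PaperTS

theorem dot_add_left {p n : ℕ} (x y z : Vec p n) : dot (x + y) z = dot x z + dot y z :=
  add_dotProduct x y z

namespace QuadFactor

variable {p n ℓ q : ℕ}

theorem betaL_add (B : QuadFactor p n ℓ q) (x y : Vec p n) :
    B.betaL (x + y) = B.betaL x + B.betaL y :=
  funext fun _ => dot_add_left _ _ _

theorem betaQ_add_left (B : QuadFactor p n ℓ q) (x y z : Vec p n) :
    B.betaQ (x + y) z = B.betaQ x z + B.betaQ y z :=
  funext fun _ => dot_add_left _ _ _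

theorem betaQ_comm (B : QuadFactor p n ℓ q) (x y : Vec p n) : B.betaQ x y = B.betaQ y x := by
  funext j
  change x ⬝ᵥ (B.Q j).mulVec y = y ⬝ᵥ (B.Q j).mulVec x
  rw [Matrix.dotProduct_mulVec, ← Matrix.mulVec_transpose, (B.symm j).eq, dotProduct_comm]

theorem betaQ_add_right (B : QuadFactor p n ℓ q) (x y z : Vec p n) :
    B.betaQ x (y + z) = B.betaQ x y + B.betaQ x z := by
  rw [betaQ_comm, betaQ_add_left, B.betaQ_comm y, B.betaQ_comm z]

/-- Translating a point of an atom by `h` stays in the atom iff `h` is orthogonal to the linear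
part and `2 β_Q(x, h) = -β_Q(h, h)`. -/
theorem add_mem_atom_iff {B : QuadFactor p n ℓ q} {ab : Label p ℓ q} {x h : Vec p n}
    (hx : x ∈ B.atom ab) :
    x + h ∈ B.atom ab ↔ B.betaL h = 0 ∧ 2 • B.betaQ x h = -B.betaQ h h := by
  have hx' : B.betaB x = ab := hx
  subst hx'
  change B.betaB (x + h) = B.betaB x ↔ _
  simp only [betaB, Prod.mk.injEq, betaL_add, add_eq_left]
  refine and_congr_right fun _ => ?_
  rw [betaQ_add_left, betaQ_add_right, betaQ_add_right, B.betaQ_comm h x, add_assoc, add_eq_left,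
    ← add_assoc, ← two_nsmul, eq_neg_iff_add_eq_zero]

/-- If three vertices of a parallelogram lie in an atom, then so does the fourth iff the two sides
are `β_Q`-orthogonal. -/
theorem add_add_mem_atom_iff {B : QuadFactor p n ℓ q} {ab : Label p ℓ q} {x h k : Vec p n}
    (hp : p.Prime) (hodd : Odd p) (hx : x ∈ B.atom ab) (hh : x + h ∈ B.atom ab)
    (hk : x + k ∈ B.atom ab) :
    x + h + k ∈ B.atom ab ↔ B.betaQ h k = 0 := by
  have := Fact.mk hp
  have h2 : (2 : ZMod p) ≠ 0 :=
    Ring.two_ne_zero (by rw [ZMod.ringChar_zmod_n]; rintro rfl; exact absurd hodd (by decide))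
  rw [add_mem_atom_iff hx] at hk
  rw [add_mem_atom_iff hh, and_iff_right hk.1, betaQ_add_left, nsmul_add, hk.2, add_eq_left,
    ← Nat.cast_smul_eq_nsmul (ZMod p), Nat.cast_ofNat, smul_eq_zero_iff_right h2]

end QuadFactor

theorem statement7 (p n ℓ q : ℕ) (hp : p.Prime) (hodd : Odd p)
    (B : QuadFactor p n ℓ q) (ab : Label p ℓ q) (x : Vec p n) (h : Fin 3 → Vec p n) :
    (x, h 0, h 1, h 2) ∈ Omega (B.atom ab) ↔
      (x ∈ B.atom ab ∧
       (∀ (i : Fin 3) (j : Fin ℓ), dot (h i) (B.L j) = 0) ∧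
       (∀ i : Fin 3, 2 • B.betaQ x (h i) = - B.betaQ (h i) (h i)) ∧
       (∀ i j : Fin 3, i ≠ j → B.betaQ (h i) (h j) = 0)) := by
  change (_ ∧ _ ∧ _ ∧ _ ∧ _ ∧ _ ∧ _ ∧ _) ↔ _
  have hL (i : Fin 3) : (∀ j : Fin ℓ, dot (h i) (B.L j) = 0) ↔ B.betaL (h i) = 0 :=
    funext_iff.symm
  simp only [hL]
  constructor
  · rintro ⟨hx, h0, h1, h2, h01, h02, h12, -⟩
    rw [QuadFactor.add_add_mem_atom_iff hp hodd hx h0 h1] at h01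
    rw [QuadFactor.add_add_mem_atom_iff hp hodd hx h0 h2] at h02
    rw [QuadFactor.add_add_mem_atom_iff hp hodd hx h1 h2] at h12
    rw [QuadFactor.add_mem_atom_iff hx] at h0 h1 h2
    refine ⟨hx, fun i => ?_, fun i => ?_, fun i j hij => ?_⟩
    · fin_cases i
      exacts [h0.1, h1.1, h2.1]
    · fin_cases i
      exacts [h0.2, h1.2, h2.2]
    · fin_cases i <;> fin_cases j <;>
        first
        | exact absurd rfl hij
        | assumption
        | (rw [QuadFactor.betaQ_comm]; assumption)
  · rintro ⟨hx, hl, hd, ho⟩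
    have hv (i : Fin 3) : x + h i ∈ B.atom ab :=
      (QuadFactor.add_mem_atom_iff hx).2 ⟨hl i, hd i⟩
    have he (i j : Fin 3) (hij : i ≠ j) : x + h i + h j ∈ B.atom ab :=
      (QuadFactor.add_add_mem_atom_iff hp hodd hx (hv i) (hv j)).2 (ho i j hij)
    exact ⟨hx, hv 0, hv 1, hv 2, he 0 1 (by decide), he 0 2 (by decide), he 1 2 (by decide),
      (QuadFactor.add_add_mem_atom_iff hp hodd (hv 0) (he 0 1 (by decide))
        (he 0 2 (by decide))).2 (ho 1 2 (by decide))⟩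

end PaperTS
end
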